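/- arXiv:2201.01575 — 6 statements merged into one kernel-verified Lean document; each statement's English description precedes it below -/
import Mathlib

section
/- Let I ⊆ ℝ be a compact nontrivial interval, let E : I → ℝ^{n×n} be continuously differentiable, A : I → ℝ^{n×n} continuous, and let Q : I → ℝ^{n×n} be continuously differentiable with Q(t) invertible for all t ∈ I. Define Ẽ(t) = Q(t)ᵀE(t)Q(t) and Ã(t) = Q(t)ᵀA(t)Q(t) − Q(t)ᵀE(t)Q̇(t). If the pair (E,A) is self-adjoint, i.e. E(t)ᵀ = −E(t) and A(t)ᵀ = A(t) + Ė(t) for all t ∈ I, then the pair (Ẽ,Ã) is self-adjoint as well, i.e. Ẽ(t)ᵀ = −Ẽ(t) and Ã(t)ᵀ = Ã(t) + Ẽ'(t) for all t ∈ I. -/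
open Matrix Set

/-- The product rule for matrix functions, with derivatives taken entrywise. -/
theorem Matrix.hasDerivWithinAt_mul_apply {l m n : Type*} [Fintype m]
    {M : ℝ → Matrix l m ℝ} {N : ℝ → Matrix m n ℝ} {M' : Matrix l m ℝ} {N' : Matrix m n ℝ}
    {s : Set ℝ} {t : ℝ}
    (hM : ∀ i j, HasDerivWithinAt (fun x => M x i j) (M' i j) s t)
    (hN : ∀ i j, HasDerivWithinAt (fun x => N x i j) (N' i j) s t) (i : l) (j : n) :
    HasDerivWithinAt (fun x => (M x * N x) i j) ((M' * N t + M t * N') i j) s t := by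
  simp only [Matrix.add_apply, Matrix.mul_apply, ← Finset.sum_add_distrib]
  exact HasDerivWithinAt.fun_sum fun k _ => (hM i k).fun_mul (hN k j)

/-- Congruence preserves the self-adjoint structure of a pair of matrix
functions: if `(E, A)` is self-adjoint on the compact nontrivial interval `[lo, hi]`,
i.e. `Eᵀ = -E` and `Aᵀ = A + Ė`, and `Q` is continuously differentiable and pointwise
invertible, then the congruent pair `(QᵀEQ, QᵀAQ - QᵀEQ̇)` is self-adjoint as well. -/
theorem selfAdjoint_of_congruent
    (n : ℕ) (lo hi : ℝ) (hlohi : lo < hi)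
    (E E' A Q Q' : ℝ → Matrix (Fin n) (Fin n) ℝ)
    -- E is continuously differentiable on [lo, hi] with derivative E'
    (hE : ∀ t ∈ Set.Icc lo hi, ∀ i j,
      HasDerivWithinAt (fun s => E s i j) (E' t i j) (Set.Icc lo hi) t)
    (hE' : ∀ i j, ContinuousOn (fun t => E' t i j) (Set.Icc lo hi))
    -- A is continuous on [lo, hi]
    (hA : ∀ i j, ContinuousOn (fun t => A t i j) (Set.Icc lo hi))
    -- Q is continuously differentiable on [lo, hi] with derivative Q'
    (hQ : ∀ t ∈ Set.Icc lo hi, ∀ i j,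
      HasDerivWithinAt (fun s => Q s i j) (Q' t i j) (Set.Icc lo hi) t)
    (hQ' : ∀ i j, ContinuousOn (fun t => Q' t i j) (Set.Icc lo hi))
    -- Q is pointwise invertible on [lo, hi]
    (hQinv : ∀ t ∈ Set.Icc lo hi, IsUnit (Q t))
    -- (E, A) is self-adjoint on [lo, hi]
    (hself : ∀ t ∈ Set.Icc lo hi, (E t)ᵀ = -E t ∧ (A t)ᵀ = A t + E' t) :
    -- then (Ẽ, Ã) = (QᵀEQ, QᵀAQ - QᵀEQ') is self-adjoint on [lo, hi]
    ∃ tE' : ℝ → Matrix (Fin n) (Fin n) ℝ,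
      (∀ t ∈ Set.Icc lo hi, ∀ i j,
        HasDerivWithinAt (fun s => ((Q s)ᵀ * E s * Q s) i j) (tE' t i j) (Set.Icc lo hi) t) ∧
      (∀ t ∈ Set.Icc lo hi,
        ((Q t)ᵀ * E t * Q t)ᵀ = -((Q t)ᵀ * E t * Q t) ∧
        ((Q t)ᵀ * A t * Q t - (Q t)ᵀ * E t * Q' t)ᵀ
          = ((Q t)ᵀ * A t * Q t - (Q t)ᵀ * E t * Q' t) + tE' t) := by
  refine ⟨fun t => ((Q' t)ᵀ * E t + (Q t)ᵀ * E' t) * Q t + (Q t)ᵀ * E t * Q' t,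
    fun t ht => ?_, fun t ht => ?_⟩
  · have hQt : ∀ i j, HasDerivWithinAt (fun s => (Q s)ᵀ i j) ((Q' t)ᵀ i j) (Set.Icc lo hi) t :=
      fun i j => hQ t ht j i
    exact Matrix.hasDerivWithinAt_mul_apply
      (Matrix.hasDerivWithinAt_mul_apply hQt (hE t ht)) (hQ t ht)
  · obtain ⟨hEt, hAt⟩ := hself t ht
    simp only [transpose_sub, transpose_mul, transpose_transpose, hEt, hAt]
    constructor <;> noncomm_ring
end

section
/- Let I ⊆ ℝ be a compact nontrivial interval, let E : I → ℝ^{n×n} be continuously differentiable, A : I → ℝ^{n×n} continuous, and let Q : I → ℝ^{n×n} be continuously differentiable with Q(t) invertible for all t ∈ I. Define Ẽ(t) = Q(t)ᵀE(t)Q(t) and Ã(t) = Q(t)ᵀA(t)Q(t) − Q(t)ᵀE(t)Q̇(t). If the pair (E,A) is skew-adjoint, i.e. E(t)ᵀ = E(t) and A(t)ᵀ = −A(t) − Ė(t) for all t ∈ I, then the pair (Ẽ,Ã) is skew-adjoint as well, i.e. Ẽ(t)ᵀ = Ẽ(t) and Ã(t)ᵀ = −Ã(t) − Ẽ'(t)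 for all t ∈ I. -/
open Matrix Set

/-- **Statement 0.** Congruence preserves the skew-adjoint structure of a pair of matrix
functions: if `(E, A)` is skew-adjoint on the compact nontrivial interval `[lo, hi]`,
i.e. `Eᵀ = E` and `Aᵀ = -A - Ė`, and `Q` is continuously differentiable and pointwise
invertible, then the congruent pair `(QᵀEQ, QᵀAQ - QᵀEQ̇)` is skew-adjoint as well. -/
theorem skewAdjoint_of_congruent
    (n : ℕ) (lo hi : ℝ) (hlohi : lo < hi)
    (E E' A Q Q' : ℝ → Matrix (Fin n) (Fin n) ℝ)
    -- E is continuously differentiable on [lo, hi] with derivative E'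
    (hE : ∀ t ∈ Set.Icc lo hi, ∀ i j,
      HasDerivWithinAt (fun s => E s i j) (E' t i j) (Set.Icc lo hi) t)
    (hE' : ∀ i j, ContinuousOn (fun t => E' t i j) (Set.Icc lo hi))
    -- A is continuous on [lo, hi]
    (hA : ∀ i j, ContinuousOn (fun t => A t i j) (Set.Icc lo hi))
    -- Q is continuously differentiable on [lo, hi] with derivative Q'
    (hQ : ∀ t ∈ Set.Icc lo hi, ∀ i j,
      HasDerivWithinAt (fun s => Q s i j) (Q' t i j) (Set.Icc lo hi) t)
    (hQ' : ∀ i j, ContinuousOn (fun t => Q' t i j) (Set.Icc lo hi))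
    -- Q is pointwise invertible on [lo, hi]
    (hQinv : ∀ t ∈ Set.Icc lo hi, IsUnit (Q t))
    -- (E, A) is skew-adjoint on [lo, hi]
    (hself : ∀ t ∈ Set.Icc lo hi, (E t)ᵀ = E t ∧ (A t)ᵀ = -A t - E' t) :
    -- then (Ẽ, Ã) = (QᵀEQ, QᵀAQ - QᵀEQ') is skew-adjoint on [lo, hi]
    ∃ tE' : ℝ → Matrix (Fin n) (Fin n) ℝ,
      (∀ t ∈ Set.Icc lo hi, ∀ i j,
        HasDerivWithinAt (fun s => ((Q s)ᵀ * E s * Q s) i j) (tE' t i j) (Set.Icc lo hi) t) ∧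
      (∀ t ∈ Set.Icc lo hi,
        ((Q t)ᵀ * E t * Q t)ᵀ = (Q t)ᵀ * E t * Q t ∧
        ((Q t)ᵀ * A t * Q t - (Q t)ᵀ * E t * Q' t)ᵀ
          = -((Q t)ᵀ * A t * Q t - (Q t)ᵀ * E t * Q' t) - tE' t) := by
  refine ⟨fun t => ((Q' t)ᵀ * E t + (Q t)ᵀ * E' t) * Q t + (Q t)ᵀ * E t * Q' t,
    fun t ht => ?_, fun t ht => ?_⟩
  · exact Matrix.hasDerivWithinAt_mul_apply (M := fun s => (Q s)ᵀ * E s)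
      (Matrix.hasDerivWithinAt_mul_apply (M := fun s => (Q s)ᵀ) (M' := (Q' t)ᵀ)
        (fun i j => hQ t ht j i) (hE t ht)) (hQ t ht)
  · obtain ⟨hEt, hAt⟩ := hself t ht
    constructor
    · simp only [transpose_mul, transpose_transpose, hEt, Matrix.mul_assoc]
    · simp only [transpose_sub, transpose_mul, transpose_transpose, hEt, hAt]
      noncomm_ring
end

section
/- Let I ⊆ ℝ be a compact nontrivial interval, k ∈ ℕ ∪ {∞}, and let E : I → ℝ^{m×n} be k times continuously differentiable with rank E(t) = r for all t ∈ I. Then there exist k times continuously differentiable matrix functions U : I → ℝ^{m×m} and V : I → ℝ^{n×n} such that U(t) and V(t) are orthogonal matrices for every t ∈ I, and U(t)ᵀE(t)V(t) has the block form [[Σ(t), 0],[0, 0]] where Σ : I → ℝ^{r×r} is k times continuously differentiable and Σ(t) is invertible for every t ∈ I. -/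
open Matrix Set

/-- A matrix function all of whose entries are `k` times continuously differentiable on `s`. -/
def EntrywiseContDiffOn {F α β : Type*} [NormedAddCommGroup F] [NormedSpace ℝ F]
    (k : WithTop ℕ∞) (A : F → Matrix α β ℝ) (s : Set F) : Prop :=
  ∀ i j, ContDiffOn ℝ k (fun t => A t i j) s

namespace EntrywiseContDiffOn

variable {F F' α β γ : Type*} [NormedAddCommGroup F] [NormedSpace ℝ F]
  [NormedAddCommGroup F'] [NormedSpace ℝ F'] {k : WithTop ℕ∞} {s : Set F}

theorem const (A : Matrix α β ℝ) : EntrywiseContDiffOn k (fun _ : F => A) s :=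
  fun _ _ => contDiffOn_const

theorem transpose {A : F → Matrix α β ℝ} (hA : EntrywiseContDiffOn k A s) :
    EntrywiseContDiffOn k (fun t => (A t)ᵀ) s :=
  fun i j => hA j i

theorem add {A B : F → Matrix α β ℝ} (hA : EntrywiseContDiffOn k A s)
    (hB : EntrywiseContDiffOn k B s) : EntrywiseContDiffOn k (fun t => A t + B t) s :=
  fun i j => (hA i j).add (hB i j)

theorem sub {A B : F → Matrix α β ℝ} (hA : EntrywiseContDiffOn k A s)
    (hB : EntrywiseContDiffOn k B s) : EntrywiseContDiffOn k (fun t => A t - B t) s :=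
  fun i j => (hA i j).sub (hB i j)

theorem mul [Fintype β] {A : F → Matrix α β ℝ} {B : F → Matrix β γ ℝ}
    (hA : EntrywiseContDiffOn k A s) (hB : EntrywiseContDiffOn k B s) :
    EntrywiseContDiffOn k (fun t => A t * B t) s := by
  intro i j
  simp only [Matrix.mul_apply]
  exact ContDiffOn.sum fun l _ => (hA i l).mul (hB l j)

theorem comp {A : F → Matrix α β ℝ} (hA : EntrywiseContDiffOn k A s) {g : F' → F} {u : Set F'}
    (hg : ContDiffOn ℝ k g u) (hgu : MapsTo g u s) :
    EntrywiseContDiffOn k (fun t => A (g t)) u :=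
  fun i j => (hA i j).comp hg hgu

theorem of_le {l : WithTop ℕ∞} {A : F → Matrix α β ℝ} (hA : EntrywiseContDiffOn k A s)
    (hl : l ≤ k) : EntrywiseContDiffOn l A s :=
  fun i j => (hA i j).of_le hl

theorem mono {A : F → Matrix α β ℝ} (hA : EntrywiseContDiffOn k A s) {u : Set F} (hu : u ⊆ s) :
    EntrywiseContDiffOn k A u :=
  fun i j => (hA i j).mono hu

theorem det [Fintype α] [DecidableEq α] {A : F → Matrix α α ℝ} (hA : EntrywiseContDiffOn k A s) :
    ContDiffOn ℝ k (fun t => (A t).det) s := by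
  simp only [Matrix.det_apply']
  exact ContDiffOn.sum fun σ _ => contDiffOn_const.mul (contDiffOn_prod fun i _ => hA _ _)

theorem inv [Fintype α] [DecidableEq α] {A : F → Matrix α α ℝ} (hA : EntrywiseContDiffOn k A s)
    (hdet : ∀ t ∈ s, (A t).det ≠ 0) : EntrywiseContDiffOn k (fun t => (A t)⁻¹) s := by
  intro i j
  simp only [Matrix.inv_def, Matrix.smul_apply, Ring.inverse_eq_inv', smul_eq_mul,
    Matrix.adjugate_apply]
  refine (hA.det.inv hdet).mul (det fun a b => ?_)
  by_cases h : a = j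
  · subst h
    simpa using contDiffOn_const
  · simpa [Matrix.updateRow_ne h] using hA a b

end EntrywiseContDiffOn

/-- `P` is the matrix of the orthogonal projection onto the column space of `A`. -/
structure Matrix.IsRangeProjection {α β : Type*} [Fintype α] [Fintype β]
    (P : Matrix α α ℝ) (A : Matrix α β ℝ) : Prop where
  transpose_eq : Pᵀ = P
  mul_eq : P * A = A
  exists_eq_mul : ∃ X : Matrix β α ℝ, P = A * X

namespace Matrix.IsRangeProjection

variable {α β : Type*} [Fintype α] [Fintype β] {P Q : Matrix α α ℝ} {A : Matrix α β ℝ}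

theorem unique (hP : P.IsRangeProjection A) (hQ : Q.IsRangeProjection A) : P = Q := by
  obtain ⟨X, hX⟩ := hP.exists_eq_mul
  obtain ⟨Y, hY⟩ := hQ.exists_eq_mul
  have hQP : Q * P = P := by rw [hX, ← Matrix.mul_assoc, hQ.mul_eq]
  have hPQ : P * Q = Q := by rw [hY, ← Matrix.mul_assoc, hP.mul_eq]
  calc P = (Q * P)ᵀ := by rw [hQP, hP.transpose_eq]
    _ = P * Q := by rw [Matrix.transpose_mul, hP.transpose_eq, hQ.transpose_eq]
    _ = Q := hPQ

theorem mul_self (hP : P.IsRangeProjection A) : P * P = P := by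
  obtain ⟨X, hX⟩ := hP.exists_eq_mul
  calc P * P = P * A * X := by rw [Matrix.mul_assoc, ← hX]
    _ = P := by rw [hP.mul_eq, ← hX]

theorem rank_eq (hP : P.IsRangeProjection A) : P.rank = A.rank := by
  obtain ⟨X, hX⟩ := hP.exists_eq_mul
  refine le_antisymm (hX ▸ Matrix.rank_mul_le_left A X) ?_
  calc A.rank = (P * A).rank := by rw [hP.mul_eq]
    _ ≤ P.rank := Matrix.rank_mul_le_left P A

end Matrix.IsRangeProjection

theorem Matrix.isUnit_det_of_rank_eq_card {α : Type*} [Fintype α] [DecidableEq α]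
    {A : Matrix α α ℝ} (h : A.rank = Fintype.card α) : IsUnit A.det := by
  rw [← Matrix.isUnit_iff_isUnit_det, ← Matrix.mulVec_surjective_iff_isUnit]
  have : LinearMap.range A.mulVecLin = ⊤ :=
    Submodule.eq_top_of_finrank_eq (by rw [← Matrix.rank, h, Module.finrank_fintype_fun_eq_card])
  exact LinearMap.range_eq_top.1 this

theorem Matrix.exists_rank_mul_eq {α β : Type*} [Fintype α] [Fintype β]
    (A : Matrix α β ℝ) {r : ℕ} (h : A.rank = r) :
    ∃ C : Matrix β (Fin r) ℝ, (A * C).rank = r := by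
  let b := Module.finBasisOfFinrankEq ℝ (LinearMap.range A.mulVecLin) h
  choose c hc using fun i => (b i).2
  refine ⟨(Matrix.of c)ᵀ, ?_⟩
  have hrow : (A * (Matrix.of c)ᵀ)ᵀ.row = (LinearMap.range A.mulVecLin).subtype ∘ b :=
    funext fun i => hc i
  have hli : LinearIndependent ℝ (A * (Matrix.of c)ᵀ)ᵀ.row := by
    rw [hrow]
    exact b.linearIndependent.map' _ (by simp)
  rw [← Matrix.rank_transpose, hli.rank_matrix, Fintype.card_fin]

theorem Matrix.isRangeProjection_of_rank_eq {α β : Type*} [Fintype α] [Fintype β] {r : ℕ}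
    {A : Matrix α β ℝ} (hA : A.rank = r) (C : Matrix β (Fin r) ℝ)
    (hdet : ((A * C)ᵀ * (A * C)).det ≠ 0) :
    ((A * C) * ((A * C)ᵀ * (A * C))⁻¹ * (A * C)ᵀ).IsRangeProjection A := by
  classical
  set B := A * C with hB
  have hunit : IsUnit (Bᵀ * B).det := hdet.isUnit
  have hBrank : B.rank = r := by
    rw [← Matrix.rank_transpose_mul_self,
      Matrix.rank_of_isUnit _ ((Matrix.isUnit_iff_isUnit_det _).2 hunit), Fintype.card_fin]
  have hrange : LinearMap.range B.mulVecLin = LinearMap.range A.mulVecLin := by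
    refine Submodule.eq_of_le_of_finrank_eq ?_ (hBrank.trans hA.symm)
    rw [hB, Matrix.mulVecLin_mul]
    exact LinearMap.range_comp_le_range _ _
  have hfac : ∃ Y : Matrix (Fin r) β ℝ, A = B * Y := by
    have hmem : ∀ j, ∃ y, B *ᵥ y = A.col j := fun j => by
      have : A.col j ∈ LinearMap.range B.mulVecLin := by
        rw [hrange]
        exact ⟨Pi.single j 1, by simp⟩
      exact this
    choose y hy using hmem
    refine ⟨(Matrix.of y)ᵀ, ?_⟩
    ext i j
    exact (congrFun (hy j) i).symm
  obtain ⟨Y, hY⟩ := hfac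
  refine ⟨?_, ?_, C * (Bᵀ * B)⁻¹ * Bᵀ, ?_⟩
  · simp [Matrix.transpose_mul, Matrix.transpose_nonsing_inv, Matrix.mul_assoc]
  · calc B * (Bᵀ * B)⁻¹ * Bᵀ * A = B * ((Bᵀ * B)⁻¹ * (Bᵀ * B)) * Y := by
          conv_lhs => rw [hY]
          simp only [Matrix.mul_assoc]
      _ = A := by rw [Matrix.nonsing_inv_mul _ hunit, Matrix.mul_one, ← hY]
  · simp only [hB, Matrix.mul_assoc]

/-- The orthogonal projection onto the column space of a `C^k` matrix function of constant rank
is `C^k`. -/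
theorem exists_contDiffOn_isRangeProjection {α β : Type*} [Fintype α] [Fintype β] {r : ℕ}
    {k : WithTop ℕ∞} {s : Set ℝ} {E : ℝ → Matrix α β ℝ} (hE : EntrywiseContDiffOn k E s)
    (hrank : ∀ t ∈ s, (E t).rank = r) :
    ∃ P : ℝ → Matrix α α ℝ, EntrywiseContDiffOn k P s ∧
      ∀ t ∈ s, (P t).IsRangeProjection (E t) := by
  classical
  have hloc : ∀ t₀ ∈ s, ∃ C : Matrix β (Fin r) ℝ, ((E t₀ * C)ᵀ * (E t₀ * C)).det ≠ 0 := by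
    intro t₀ ht₀
    obtain ⟨C, hC⟩ := (E t₀).exists_rank_mul_eq (hrank t₀ ht₀)
    refine ⟨C, (Matrix.isUnit_det_of_rank_eq_card ?_).ne_zero⟩
    rw [Matrix.rank_transpose_mul_self, hC, Fintype.card_fin]
  choose! C hC using hloc
  let Q (t₀ t : ℝ) : Matrix α α ℝ :=
    (E t * C t₀) * ((E t * C t₀)ᵀ * (E t * C t₀))⁻¹ * (E t * C t₀)ᵀ
  have hproj : ∀ t ∈ s, (Q t t).IsRangeProjection (E t) := fun t ht =>
    Matrix.isRangeProjection_of_rank_eq (hrank t ht) (C t) (hC t ht)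
  refine ⟨fun t => Q t t, fun i j t₀ ht₀ => ?_, hproj⟩
  have hB : EntrywiseContDiffOn k (fun t => E t * C t₀) s := hE.mul (.const _)
  have hgram := hB.transpose.mul hB
  let u : Set ℝ := {t ∈ s | ((E t * C t₀)ᵀ * (E t * C t₀)).det ≠ 0}
  have hus : u ⊆ s := fun t ht => ht.1
  have hQ : EntrywiseContDiffOn k (Q t₀) u :=
    ((hB.mono hus).mul ((hgram.mono hus).inv fun t ht => ht.2)).mul (hB.mono hus).transpose
  have hu : u ∈ nhdsWithin t₀ s := by
    have hne := (hgram.det.continuousOn t₀ ht₀).eventually_ne (hC t₀ ht₀)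
    filter_upwards [self_mem_nhdsWithin, hne] with t ht ht' using ⟨ht, ht'⟩
  have heq : ∀ t ∈ u, Q t t = Q t₀ t := fun t ht =>
    (hproj t ht.1).unique (Matrix.isRangeProjection_of_rank_eq (hrank t ht.1) (C t₀) ht.2)
  have hcd : ContDiffWithinAt ℝ k (fun t => Q t t i j) u t₀ :=
    (hQ i j t₀ ⟨ht₀, hC t₀ ht₀⟩).congr (fun t ht => by rw [heq t ht]) rfl
  exact hcd.mono_of_mem_nhdsWithin hu

/-- A `C^k` family of idempotent matrices over a compact interval is conjugate to its value at the
left endpoint, through a `C^k` family of invertible matrices. -/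
theorem exists_contDiffOn_intertwining {α : Type*} [Fintype α] [DecidableEq α]
    {k : WithTop ℕ∞} {lo hi : ℝ} (hlohi : lo < hi) {P : ℝ → Matrix α α ℝ}
    (hP : EntrywiseContDiffOn k P (Icc lo hi)) (hidem : ∀ t ∈ Icc lo hi, P t * P t = P t) :
    ∃ S : ℝ → Matrix α α ℝ, EntrywiseContDiffOn k S (Icc lo hi) ∧
      (∀ t ∈ Icc lo hi, (S t).det ≠ 0) ∧ ∀ t ∈ Icc lo hi, P t * S t = S t * P lo := by
  let G (t s : ℝ) : Matrix α α ℝ := P t * P s + (1 - P t) * (1 - P s)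
  have hG : ∀ t ∈ Icc lo hi, ∀ s ∈ Icc lo hi, P t * G t s = G t s * P s := fun t ht s hs => by
    simp only [G, mul_add, add_mul, mul_sub, sub_mul, mul_one, one_mul, Matrix.mul_assoc,
      hidem s hs]
    simp only [← Matrix.mul_assoc, hidem t ht]
    abel
  have hG_diag : ∀ t ∈ Icc lo hi, G t t = 1 := fun t ht => by
    simp only [G, mul_sub, sub_mul, mul_one, one_mul, hidem t ht]
    abel
  have hGcomp : ∀ {F : Type} [NormedAddCommGroup F] [NormedSpace ℝ F] {l : WithTop ℕ∞}
      {f g : F → ℝ} {u : Set F}, l ≤ k → ContDiffOn ℝ l f u → ContDiffOn ℝ l g u →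
      MapsTo f u (Icc lo hi) → MapsTo g u (Icc lo hi) →
      EntrywiseContDiffOn l (fun x => G (f x) (g x)) u := by
    intro F _ _ l f g u hl hf hg hfu hgu
    have hPf := (hP.of_le hl).comp hf hfu
    have hPg := (hP.of_le hl).comp hg hgu
    exact (hPf.mul hPg).add (((EntrywiseContDiffOn.const 1).sub hPf).mul
      ((EntrywiseContDiffOn.const 1).sub hPg))
  obtain ⟨δ, hδ, hdet⟩ : ∃ δ > 0, ∀ t ∈ Icc lo hi, ∀ s ∈ Icc lo hi, |t - s| < δ →
      (G t s).det ≠ 0 := by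
    have hcont : ContinuousOn (fun x : ℝ × ℝ => (G x.1 x.2).det) (Icc lo hi ×ˢ Icc lo hi) :=
      (hGcomp (l := 0) zero_le contDiff_fst.contDiffOn contDiff_snd.contDiffOn
        (fun x hx => hx.1) (fun x hx => hx.2)).det.continuousOn
    have huc := (isCompact_Icc.prod isCompact_Icc).uniformContinuousOn_of_continuous hcont
    obtain ⟨δ, hδ, h⟩ := Metric.uniformContinuousOn_iff.1 huc 1 one_pos
    refine ⟨δ, hδ, fun t ht s hs hts h0 => ?_⟩
    have := h (t, s) ⟨ht, hs⟩ (s, s) ⟨hs, hs⟩ (by simpa [Prod.dist_eq, Real.dist_eq, hδ] using hts)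
    simp [hG_diag s hs, h0] at this
  obtain ⟨N, hN⟩ := exists_nat_gt ((hi - lo) / δ)
  have hN0 : (0 : ℝ) < N := (div_pos (sub_pos.2 hlohi) hδ).trans hN
  let p (i : ℕ) (t : ℝ) : ℝ := lo + i / N * (t - lo)
  have hp_mem : ∀ i ≤ N, MapsTo (p i) (Icc lo hi) (Icc lo hi) := fun i hi' t ht => by
    have h1 : (i : ℝ) / N ≤ 1 := (div_le_one hN0).2 (by exact_mod_cast hi')
    have h0 : 0 ≤ (i : ℝ) / N := by positivity
    have := ht.1
    have := ht.2
    constructor <;> simp only [p] <;> nlinarith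
  have hp_cd : ∀ i, ContDiffOn ℝ k (p i) (Icc lo hi) := fun i =>
    contDiffOn_const.add (contDiffOn_const.mul (contDiffOn_id.sub contDiffOn_const))
  have hp_close : ∀ i, ∀ t ∈ Icc lo hi, |p (i + 1) t - p i t| < δ := fun i t ht => by
    have heq : p (i + 1) t - p i t = (t - lo) / N := by
      simp only [p]
      push_cast
      ring
    rw [heq, abs_of_nonneg (div_nonneg (sub_nonneg.2 ht.1) hN0.le), div_lt_iff₀ hN0]
    rw [div_lt_iff₀ hδ] at hN
    linarith [ht.2]
  have key : ∀ i ≤ N, ∃ S : ℝ → Matrix α α ℝ, EntrywiseContDiffOn k S (Icc lo hi) ∧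
      (∀ t ∈ Icc lo hi, (S t).det ≠ 0) ∧
      ∀ t ∈ Icc lo hi, P (p i t) * S t = S t * P lo := by
    intro i
    induction i with
    | zero => exact fun _ => ⟨fun _ => 1, .const 1, by simp, by simp [p]⟩
    | succ i ih =>
      intro hiN
      obtain ⟨S, hS, hSdet, hPS⟩ := ih (by omega)
      have h1 := hp_mem (i + 1) hiN
      have h2 := hp_mem i (by omega)
      refine ⟨fun t => G (p (i + 1) t) (p i t) * S t,
        (hGcomp le_rfl (hp_cd _) (hp_cd _) h1 h2).mul hS, fun t ht => ?_, fun t ht => ?_⟩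
      · rw [Matrix.det_mul]
        exact mul_ne_zero (hdet _ (h1 ht) _ (h2 ht) (hp_close i t ht)) (hSdet t ht)
      · rw [← Matrix.mul_assoc, hG _ (h1 ht) _ (h2 ht), Matrix.mul_assoc, hPS t ht,
          Matrix.mul_assoc]
  obtain ⟨S, hS, hSdet, hPS⟩ := key N le_rfl
  refine ⟨S, hS, hSdet, fun t ht => ?_⟩
  have hpN : p N t = t := by
    simp only [p]
    field_simp
    ring
  simpa [hpN] using hPS t ht

open InnerProductSpace in
/-- Gram–Schmidt orthonormalization of the columns of a `C^k` family of invertible matrices. -/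
theorem exists_contDiffOn_orthogonal_triangular {m : ℕ} {k : WithTop ℕ∞} {s : Set ℝ}
    {T : ℝ → Matrix (Fin m) (Fin m) ℝ} (hT : EntrywiseContDiffOn k T s)
    (hdet : ∀ t ∈ s, (T t).det ≠ 0) :
    ∃ U : ℝ → Matrix (Fin m) (Fin m) ℝ, EntrywiseContDiffOn k U s ∧
      (∀ t ∈ s, (U t)ᵀ * U t = 1) ∧ ∀ t, ∀ i j, i < j → ((U t)ᵀ * T t) j i = 0 := by
  let c (t : ℝ) (j : Fin m) : EuclideanSpace ℝ (Fin m) := WithLp.toLp 2 ((T t).col j)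
  have hc : ∀ j, ContDiffOn ℝ k (fun t => c t j) s := fun j =>
    contDiffOn_euclidean.2 fun i => hT i j
  have hli : ∀ t ∈ s, LinearIndependent ℝ (c t) := fun t ht => by
    have := Matrix.linearIndependent_cols_of_det_ne_zero (hdet t ht)
    exact this.map' (WithLp.linearEquiv 2 ℝ (Fin m → ℝ)).symm.toLinearMap (LinearEquiv.ker _)
  have hgs : ∀ j, ContDiffOn ℝ k (fun t => gramSchmidt ℝ (c t) j) s := by
    intro j
    induction j using WellFoundedLT.induction with
    | ind j ih =>
      simp only [gramSchmidt_def ℝ _ j, Submodule.starProjection_singleton]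
      refine (hc j).sub (ContDiffOn.sum fun i hij => ?_)
      have hi := ih i (Finset.mem_Iio.1 hij)
      refine ContDiffOn.smul (ContDiffOn.div (hi.inner ℝ (hc j)) ?_ fun t ht => ?_) hi
      · simpa using hi.norm_sq ℝ
      · simpa using gramSchmidt_ne_zero i (hli t ht)
  have hgsn : ∀ j, ContDiffOn ℝ k (fun t => gramSchmidtNormed ℝ (c t) j) s := fun j => by
    have hne : ∀ t ∈ s, gramSchmidt ℝ (c t) j ≠ 0 := fun t ht => gramSchmidt_ne_zero j (hli t ht)
    exact (((hgs j).norm ℝ hne).inv fun t ht => norm_ne_zero_iff.2 (hne t ht)).smul (hgs j)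
  refine ⟨fun t => (Matrix.of fun j => (gramSchmidtNormed ℝ (c t) j).ofLp)ᵀ,
    fun i j => contDiffOn_euclidean.1 (hgsn j) i, fun t ht => ?_, fun t i j hij => ?_⟩
  · ext i j
    have h := orthonormal_iff_ite.1 (gramSchmidtNormed_orthonormal (hli t ht)) i j
    rw [Matrix.one_apply, ← h]
    simp [Matrix.mul_apply, PiLp.inner_apply, mul_comm]
  · have h : inner ℝ (gramSchmidtNormed ℝ (c t) j) (c t i) = 0 := by
      simp [gramSchmidtNormed, inner_smul_left, gramSchmidt_inv_triangular ℝ (c t) hij]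
    rw [← h]
    simp [Matrix.mul_apply, PiLp.inner_apply, c, mul_comm]

/-- Row reduction: an invertible matrix moves the column space of `A` onto the span of the first
`A.rank` standard basis vectors. -/
theorem Matrix.exists_isUnit_mul_apply_eq_zero {m r : ℕ} {A : Matrix (Fin m) (Fin m) ℝ}
    (hA : A.rank = r) :
    ∃ W : Matrix (Fin m) (Fin m) ℝ, IsUnit W ∧ ∀ (i : Fin m) j, r ≤ (i : ℕ) → (W * A) i j = 0 := by
  obtain ⟨V, Z, e, hV, hZ, h⟩ := A.exists_rank_normal_form
  have hle : A.rank ≤ m := by simpa using A.rank_le_height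
  let f : Fin m ≃ Fin A.rank ⊕ Fin (Fintype.card (Fin m) - A.rank) :=
    (finCongr (by simp [hle])).trans finSumFinEquiv.symm
  let σ : Fin m ≃ Fin m := f.trans e.symm
  have hZ' : IsUnit Z.det := (Matrix.isUnit_iff_isUnit_det _).1 hZ
  refine ⟨V.submatrix σ id, ?_, fun i j hi => ?_⟩
  · rw [Matrix.isUnit_iff_isUnit_det] at hV ⊢
    have : V.submatrix σ id = (V.submatrix σ σ).submatrix id σ.symm := by
      ext
      simp
    rw [this, Matrix.det_permute', Matrix.det_submatrix_equiv_self]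
    exact IsUnit.mul (by simp) hV
  · have hVA : V * A = (fromBlocks 1 0 0 0).submatrix e e * Z⁻¹ := by
      rw [← h, Matrix.mul_assoc, Matrix.mul_nonsing_inv _ hZ', Matrix.mul_one]
    obtain ⟨l, hl⟩ : ∃ l, f i = Sum.inr l := by
      rcases hfi : f i with a | a
      · have : i = f.symm (Sum.inl a) := by rw [← hfi, Equiv.symm_apply_apply]
        have hia : (i : ℕ) = a := by
          rw [this]
          simp [f]
        omega
      · exact ⟨a, rfl⟩
    change (V * A) (σ i) j = 0
    rw [hVA, Matrix.mul_apply]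
    refine Finset.sum_eq_zero fun x _ => ?_
    have : e (σ i) = Sum.inr l := by simp [σ, hl]
    rw [Matrix.submatrix_apply, this]
    rcases e x with y | y <;> simp

/-- A `C^k` matrix function of constant rank `r` on a compact interval is compressed to its first
`r` rows by a `C^k` pointwise orthogonal matrix function. -/
theorem exists_contDiffOn_orthogonal_row_compression {m r : ℕ} {β : Type*} [Fintype β]
    {k : WithTop ℕ∞} {lo hi : ℝ} (hlohi : lo < hi) {E : ℝ → Matrix (Fin m) β ℝ}
    (hE : EntrywiseContDiffOn k E (Icc lo hi)) (hrank : ∀ t ∈ Icc lo hi, (E t).rank = r) :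
    ∃ U : ℝ → Matrix (Fin m) (Fin m) ℝ, EntrywiseContDiffOn k U (Icc lo hi) ∧
      (∀ t ∈ Icc lo hi, (U t)ᵀ * U t = 1) ∧
      ∀ t ∈ Icc lo hi, ∀ (i : Fin m) j, r ≤ (i : ℕ) → ((U t)ᵀ * E t) i j = 0 := by
  obtain ⟨P, hP, hproj⟩ := exists_contDiffOn_isRangeProjection hE hrank
  obtain ⟨S, hS, hSdet, hPS⟩ :=
    exists_contDiffOn_intertwining hlohi hP fun t ht => (hproj t ht).mul_self
  have hlo : lo ∈ Icc lo hi := left_mem_Icc.2 hlohi.le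
  obtain ⟨W, hW, hWP⟩ :=
    Matrix.exists_isUnit_mul_apply_eq_zero ((hproj lo hlo).rank_eq.trans (hrank lo hlo))
  have hWdet : IsUnit W.det := (Matrix.isUnit_iff_isUnit_det _).1 hW
  obtain ⟨U, hU, hUorth, hUtri⟩ :=
    exists_contDiffOn_orthogonal_triangular (T := fun t => S t * W⁻¹) (hS.mul (.const _))
      fun t ht => by
        rw [Matrix.det_mul]
        exact mul_ne_zero (hSdet t ht) (Matrix.isUnit_nonsing_inv_det _ hWdet).ne_zero
  refine ⟨U, hU, hUorth, fun t ht j c hj => ?_⟩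
  have hSS : S t * (S t)⁻¹ = 1 := Matrix.mul_nonsing_inv _ (hSdet t ht).isUnit
  have hfac : (U t)ᵀ * E t = ((U t)ᵀ * (S t * W⁻¹)) * (W * P lo * ((S t)⁻¹ * E t)) :=
    calc (U t)ᵀ * E t = (U t)ᵀ * (P t * (S t * (S t)⁻¹) * E t) := by
          rw [hSS, Matrix.mul_one, (hproj t ht).mul_eq]
      _ = (U t)ᵀ * (S t * (W⁻¹ * W) * P lo * ((S t)⁻¹ * E t)) := by
          rw [← Matrix.mul_assoc (P t), hPS t ht, Matrix.nonsing_inv_mul _ hWdet, Matrix.mul_one]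
          simp only [Matrix.mul_assoc]
      _ = _ := by simp only [Matrix.mul_assoc]
  rw [hfac, Matrix.mul_apply]
  refine Finset.sum_eq_zero fun i _ => ?_
  by_cases hi' : (i : ℕ) < r
  · rw [hUtri t i j (Fin.lt_def.2 (hi'.trans_le hj)), zero_mul]
  · have : (W * P lo * ((S t)⁻¹ * E t)) i c = 0 := by
      rw [Matrix.mul_apply]
      exact Finset.sum_eq_zero fun l _ => by rw [hWP i l (not_lt.1 hi'), zero_mul]
    rw [this, mul_zero]

theorem Matrix.isUnit_of_le_rank_fromBlocks {r a b : Type*} [Fintype r] [Fintype a] [Fintype b]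
    [DecidableEq r] {A : Matrix r r ℝ}
    (h : Fintype.card r ≤ (fromBlocks A 0 0 (0 : Matrix a b ℝ)).rank) : IsUnit A := by
  classical
  rw [Matrix.isUnit_iff_isUnit_det]
  refine Matrix.isUnit_det_of_rank_eq_card (le_antisymm A.rank_le_card_width ?_)
  have hfac : fromBlocks A 0 0 (0 : Matrix a b ℝ) =
      fromRows (1 : Matrix r r ℝ) (0 : Matrix a r ℝ) *
        (A * fromCols (1 : Matrix r r ℝ) (0 : Matrix r b ℝ)) := by
    ext (i | i) (j | j) <;> simp [Matrix.mul_fromCols, Matrix.fromRows_mul]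
  calc Fintype.card r ≤ _ := h
    _ ≤ (A * fromCols (1 : Matrix r r ℝ) (0 : Matrix r b ℝ)).rank :=
        hfac ▸ Matrix.rank_mul_le_right _ _
    _ ≤ A.rank := Matrix.rank_mul_le_left _ _

/-- (Smooth rank decomposition, Theorem 2.4.)
Let `E : [lo, hi] → ℝ^{m×n}` be `k` times continuously differentiable with
`rank E(t) = r` for all `t`.  Then there exist `k` times continuously differentiable,
pointwise orthogonal matrix functions `U`, `V` such that
`Uᵀ E V = [[Σ, 0], [0, 0]]` with `Σ : [lo, hi] → ℝ^{r×r}` `k` times continuously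
differentiable and pointwise invertible. -/
theorem smooth_rank_decomposition
    (m n r : ℕ) (lo hi : ℝ) (hlohi : lo < hi) (k : ℕ∞)
    (E : ℝ → Matrix (Fin m) (Fin n) ℝ)
    (hE : ∀ i j, ContDiffOn ℝ k (fun t => E t i j) (Set.Icc lo hi))
    (hrank : ∀ t ∈ Set.Icc lo hi, (E t).rank = r) :
    ∃ (m' n' : ℕ) (hm : r + m' = m) (hn : r + n' = n)
      (U : ℝ → Matrix (Fin m) (Fin m) ℝ) (V : ℝ → Matrix (Fin n) (Fin n) ℝ)
      (Sig : ℝ → Matrix (Fin r) (Fin r) ℝ),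
      (∀ i j, ContDiffOn ℝ k (fun t => U t i j) (Set.Icc lo hi)) ∧
      (∀ i j, ContDiffOn ℝ k (fun t => V t i j) (Set.Icc lo hi)) ∧
      (∀ i j, ContDiffOn ℝ k (fun t => Sig t i j) (Set.Icc lo hi)) ∧
      (∀ t ∈ Set.Icc lo hi, (U t)ᵀ * U t = 1) ∧
      (∀ t ∈ Set.Icc lo hi, (V t)ᵀ * V t = 1) ∧
      (∀ t ∈ Set.Icc lo hi, IsUnit (Sig t)) ∧
      (∀ t ∈ Set.Icc lo hi,
        (U t)ᵀ * E t * V t =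
          Matrix.reindex (finSumFinEquiv.trans (finCongr hm))
            (finSumFinEquiv.trans (finCongr hn))
            (Matrix.fromBlocks (Sig t) 0 0 0)) := by
  have hlo : lo ∈ Icc lo hi := left_mem_Icc.2 hlohi.le
  have hrm : r ≤ m := hrank lo hlo ▸ by simpa using (E lo).rank_le_height
  have hrn : r ≤ n := hrank lo hlo ▸ by simpa using (E lo).rank_le_width
  obtain ⟨m', rfl⟩ := Nat.exists_eq_add_of_le hrm
  obtain ⟨n', rfl⟩ := Nat.exists_eq_add_of_le hrn
  have hE' : EntrywiseContDiffOn k E (Icc lo hi) := hE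
  obtain ⟨U, hU, hUorth, hUE⟩ := exists_contDiffOn_orthogonal_row_compression hlohi hE' hrank
  obtain ⟨V, hV, hVorth, hVE⟩ := exists_contDiffOn_orthogonal_row_compression hlohi hE'.transpose
    fun t ht => (Matrix.rank_transpose _).trans (hrank t ht)
  let D (t : ℝ) := (U t)ᵀ * E t * V t
  have hD : EntrywiseContDiffOn k D (Icc lo hi) := (hU.transpose.mul hE').mul hV
  let Sig (t : ℝ) : Matrix (Fin r) (Fin r) ℝ := (D t).submatrix (Fin.castAdd m') (Fin.castAdd n')
  have hDrow : ∀ t ∈ Icc lo hi, ∀ (i : Fin (r + m')) j, r ≤ (i : ℕ) → D t i j = 0 := fun t ht i j hi' => by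
    simp only [D, Matrix.mul_apply (M := (U t)ᵀ * E t)]
    exact Finset.sum_eq_zero fun l _ => by rw [hUE t ht i l hi', zero_mul]
  have hDcol : ∀ t ∈ Icc lo hi, ∀ i (j : Fin (r + n')), r ≤ (j : ℕ) → D t i j = 0 := fun t ht i j hj => by
    have hEV : ∀ l, (E t * V t) l j = 0 := fun l => by
      simpa [Matrix.mul_apply, mul_comm] using hVE t ht j l hj
    simp only [D, Matrix.mul_assoc, Matrix.mul_apply (M := (U t)ᵀ)]
    exact Finset.sum_eq_zero fun l _ => by rw [hEV, mul_zero]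
  have hblock : ∀ t ∈ Icc lo hi, (D t).submatrix finSumFinEquiv finSumFinEquiv =
      Matrix.fromBlocks (Sig t) 0 0 0 := fun t ht => by
    ext (i | i) (j | j)
    · simp [Sig]
    · simpa using hDcol t ht _ _ (by simp)
    · simpa using hDrow t ht _ _ (by simp)
    · simpa using hDrow t ht _ _ (by simp)
  have hDrank : ∀ t ∈ Icc lo hi, (D t).rank = r := fun t ht => by
    rw [Matrix.rank_mul_eq_left_of_isUnit_det _ _ (Matrix.isUnit_det_of_left_inverse (hVorth t ht)),
      Matrix.rank_mul_eq_right_of_isUnit_det _ _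
        (Matrix.isUnit_det_of_right_inverse (hUorth t ht)), hrank t ht]
  refine ⟨m', n', rfl, rfl, U, V, Sig, hU, hV, fun i j => hD _ _, hUorth, hVorth,
    fun t ht => Matrix.isUnit_of_le_rank_fromBlocks (a := Fin m') (b := Fin n') ?_,
    fun t ht => ?_⟩
  · rw [← hblock t ht, Matrix.rank_submatrix, hDrank t ht, Fintype.card_fin]
  · rw [← hblock t ht]
    ext i j
    simp [D]
end

section
/- Let I ⊆ ℝ be a compact nontrivial interval, k ∈ ℕ ∪ {∞}, and let E : I → ℝ^{n×n} be k times continuously differentiable with rank E(t) = r for all t ∈ I and with ker E(t)ᵀ = ker E(t) for all t ∈ I. Then there exists a k times continuously differentiable matrix function Q : I → ℝ^{n×n} such that Q(t) is an orthogonal matrix for every t ∈ I and Q(t)ᵀE(t)Q(t) has the block form [[Σ(t), 0],[0, 0]] where Σ : I → ℝ^{r×r} is k times continuously differentiable and Σ(t) is invertible for every t ∈ I. -/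
open Matrix Set

section MatrixCalculus

variable {F : Type*} [NormedAddCommGroup F] [NormedSpace ℝ F] {m : WithTop ℕ∞} {s : Set F}
  {ι κ μ : Type*}

theorem contDiffOn_matrix_mul [Fintype κ] {A : F → Matrix ι κ ℝ} {B : F → Matrix κ μ ℝ}
    (hA : ∀ i j, ContDiffOn ℝ m (fun x => A x i j) s)
    (hB : ∀ i j, ContDiffOn ℝ m (fun x => B x i j) s) (i : ι) (j : μ) :
    ContDiffOn ℝ m (fun x => (A x * B x) i j) s := by
  simp only [Matrix.mul_apply]
  exact ContDiffOn.sum fun l _ => (hA i l).mul (hB l j)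

theorem contDiffOn_matrix_det [Fintype ι] [DecidableEq ι] {A : F → Matrix ι ι ℝ}
    (hA : ∀ i j, ContDiffOn ℝ m (fun x => A x i j) s) :
    ContDiffOn ℝ m (fun x => (A x).det) s := by
  simp only [Matrix.det_apply']
  exact ContDiffOn.sum fun σ _ => contDiffOn_const.mul (contDiffOn_prod fun i _ => hA _ _)

theorem contDiffOn_matrix_inv [Fintype ι] [DecidableEq ι] {A : F → Matrix ι ι ℝ}
    (hA : ∀ i j, ContDiffOn ℝ m (fun x => A x i j) s) (hdet : ∀ x ∈ s, (A x).det ≠ 0)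
    (i j : ι) : ContDiffOn ℝ m (fun x => (A x)⁻¹ i j) s := by
  simp only [Matrix.inv_def, Ring.inverse_eq_inv', Matrix.smul_apply, smul_eq_mul,
    Matrix.adjugate_apply]
  refine ((contDiffOn_matrix_det hA).inv hdet).mul (contDiffOn_matrix_det fun a b => ?_)
  by_cases h : a = j
  · subst h
    simpa using contDiffOn_const
  · simpa [Matrix.updateRow_apply, h] using hA a b

end MatrixCalculus

section RangeProjection

variable {n r : ℕ}

theorem isUnit_of_rank_eq {A : Matrix (Fin r) (Fin r) ℝ} (h : A.rank = r) : IsUnit A := by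
  rw [← Matrix.mulVec_surjective_iff_isUnit]
  have : LinearMap.range A.mulVecLin = ⊤ :=
    Submodule.eq_top_of_finrank_eq (by simpa [Matrix.rank] using h)
  exact LinearMap.range_eq_top.1 this

theorem exists_gram_mul_det_ne_zero {M : Matrix (Fin n) (Fin n) ℝ} (h : M.rank = r) :
    ∃ W : Matrix (Fin n) (Fin r) ℝ, ((M * W)ᵀ * (M * W)).det ≠ 0 := by
  have b : Module.Basis (Fin r) ℝ (LinearMap.range M.mulVecLin) :=
    Module.finBasisOfFinrankEq ℝ _ h
  choose w hw using fun j => (b j).2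
  refine ⟨(Matrix.of w)ᵀ, ?_⟩
  have hcol : (M * (Matrix.of w)ᵀ)ᵀ = Matrix.of fun j => (b j : Fin n → ℝ) := by
    ext j i
    rw [Matrix.of_apply, ← hw j]
    simp [Matrix.mul_apply, Matrix.mulVec, dotProduct]
  have hli : LinearIndependent ℝ (M * (Matrix.of w)ᵀ)ᵀ.row := by
    rw [hcol]
    exact b.linearIndependent.map' (Submodule.subtype _) (Submodule.ker_subtype _)
  have hr := hli.rank_matrix
  rw [Matrix.rank_transpose, Fintype.card_fin, ← Matrix.rank_transpose_mul_self] at hr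
  exact ((Matrix.isUnit_iff_isUnit_det _).1 (isUnit_of_rank_eq hr)).ne_zero

/-- The orthogonal projection onto the column space of a matrix with independent columns. -/
noncomputable def columnProjection (A : Matrix (Fin n) (Fin r) ℝ) : Matrix (Fin n) (Fin n) ℝ :=
  A * (Aᵀ * A)⁻¹ * Aᵀ

theorem columnProjection_transpose (A : Matrix (Fin n) (Fin r) ℝ) :
    (columnProjection A)ᵀ = columnProjection A := by
  simp [columnProjection, Matrix.transpose_nonsing_inv, Matrix.mul_assoc]

theorem columnProjection_mul_self {A : Matrix (Fin n) (Fin r) ℝ} (h : (Aᵀ * A).det ≠ 0) :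
    columnProjection A * A = A := by
  rw [columnProjection, Matrix.mul_assoc, Matrix.mul_assoc,
    Matrix.nonsing_inv_mul _ (isUnit_iff_ne_zero.2 h), Matrix.mul_one]

theorem columnProjection_idem {A : Matrix (Fin n) (Fin r) ℝ} (h : (Aᵀ * A).det ≠ 0) :
    columnProjection A * columnProjection A = columnProjection A := by
  conv_lhs =>
    enter [2]
    rw [columnProjection, Matrix.mul_assoc]
  rw [← Matrix.mul_assoc, columnProjection_mul_self h, ← Matrix.mul_assoc, columnProjection]

theorem columnProjection_rank_le (A : Matrix (Fin n) (Fin r) ℝ) :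
    (columnProjection A).rank ≤ r := by
  rw [columnProjection, Matrix.mul_assoc]
  exact (Matrix.rank_mul_le_left _ _).trans (by simpa using Matrix.rank_le_width A)

theorem columnProjection_mul {M : Matrix (Fin n) (Fin n) ℝ} {W : Matrix (Fin n) (Fin r) ℝ}
    (hM : M.rank = r) (h : ((M * W)ᵀ * (M * W)).det ≠ 0) :
    columnProjection (M * W) * M = M := by
  have hrk : (M * W).rank = r := by
    rw [← Matrix.rank_transpose_mul_self, Matrix.rank_of_isUnit, Fintype.card_fin]
    exact (Matrix.isUnit_iff_isUnit_det _).2 (isUnit_iff_ne_zero.2 h)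
  have hrange : LinearMap.range (M * W).mulVecLin = LinearMap.range M.mulVecLin := by
    apply Submodule.eq_of_le_of_finrank_eq
    · rw [Matrix.mulVecLin_mul]
      exact LinearMap.range_comp_le_range _ _
    · exact hrk.trans hM.symm
  apply Matrix.ext_of_mulVec_single
  intro j
  obtain ⟨c, hc⟩ : M *ᵥ Pi.single j 1 ∈ LinearMap.range (M * W).mulVecLin := by
    rw [hrange]
    exact ⟨_, rfl⟩
  rw [← Matrix.mulVec_mulVec, ← hc, Matrix.mulVecLin_apply, Matrix.mulVec_mulVec,
    columnProjection_mul_self h]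

theorem columnProjection_mul_eq {M : Matrix (Fin n) (Fin n) ℝ}
    {W W' : Matrix (Fin n) (Fin r) ℝ} (hM : M.rank = r)
    (h : ((M * W)ᵀ * (M * W)).det ≠ 0) (h' : ((M * W')ᵀ * (M * W')).det ≠ 0) :
    columnProjection (M * W) = columnProjection (M * W') := by
  have key : ∀ {W W' : Matrix (Fin n) (Fin r) ℝ}, ((M * W)ᵀ * (M * W)).det ≠ 0 →
      columnProjection (M * W) * columnProjection (M * W') = columnProjection (M * W') := by
    intro W W' h
    conv_lhs => rw [columnProjection.eq_def (M * W')]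
    rw [Matrix.mul_assoc M, Matrix.mul_assoc M, ← Matrix.mul_assoc _ M, columnProjection_mul hM h,
      ← Matrix.mul_assoc M, ← Matrix.mul_assoc M, columnProjection]
  have h₁ := congrArg Matrix.transpose (key (W' := W') h)
  rw [Matrix.transpose_mul, columnProjection_transpose, columnProjection_transpose, key h'] at h₁
  exact h₁

theorem exists_contDiffOn_range_projection {m : WithTop ℕ∞} {s : Set ℝ}
    {E : ℝ → Matrix (Fin n) (Fin n) ℝ} (hE : ∀ i j, ContDiffOn ℝ m (fun t => E t i j) s)
    (hrank : ∀ t ∈ s, (E t).rank = r) :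
    ∃ P : ℝ → Matrix (Fin n) (Fin n) ℝ,
      (∀ i j, ContDiffOn ℝ m (fun t => P t i j) s) ∧
      ∀ t ∈ s, (P t)ᵀ = P t ∧ P t * P t = P t ∧ P t * E t = E t ∧ (P t).rank = r := by
  choose! W hW using fun t (ht : t ∈ s) => exists_gram_mul_det_ne_zero (hrank t ht)
  refine ⟨fun t => columnProjection (E t * W t), fun i j t₀ ht₀ => ?_, fun t ht => ?_⟩
  · let A : ℝ → Matrix (Fin n) (Fin r) ℝ := fun t => E t * W t₀
    have hA : ∀ i j, ContDiffOn ℝ m (fun t => A t i j) s :=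
      contDiffOn_matrix_mul hE fun _ _ => contDiffOn_const
    have hAt : ∀ i j, ContDiffOn ℝ m (fun t => (A t)ᵀ i j) s := fun i j => hA j i
    have hG : ∀ i j, ContDiffOn ℝ m (fun t => ((A t)ᵀ * A t) i j) s :=
      contDiffOn_matrix_mul hAt hA
    have hev : ∀ᶠ t in nhdsWithin t₀ s, ((A t)ᵀ * A t).det ≠ 0 :=
      ((contDiffOn_matrix_det hG).continuousOn t₀ ht₀).eventually_ne (hW t₀ ht₀)
    let s' : Set ℝ := {t ∈ s | ((A t)ᵀ * A t).det ≠ 0}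
    have hs' : s' ⊆ s := fun t ht => ht.1
    have hmem : s' ∈ nhdsWithin t₀ s := Filter.inter_mem self_mem_nhdsWithin hev
    have hP : ContDiffOn ℝ m (fun t => columnProjection (A t) i j) s' :=
      contDiffOn_matrix_mul (contDiffOn_matrix_mul (fun i j => (hA i j).mono hs')
        (contDiffOn_matrix_inv (fun i j => (hG i j).mono hs') fun t ht => ht.2))
        (fun i j => (hAt i j).mono hs') i j
    refine ContDiffWithinAt.mono_of_mem_nhdsWithin ?_ hmem
    refine (hP.congr fun t ht => ?_) t₀ ⟨ht₀, hW t₀ ht₀⟩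
    exact congrFun (congrFun (columnProjection_mul_eq (hrank t ht.1) (hW t ht.1) ht.2) i) j
  · have hPE := columnProjection_mul (hrank t ht) (hW t ht)
    refine ⟨columnProjection_transpose _, columnProjection_idem (hW t ht), hPE,
      le_antisymm (columnProjection_rank_le _) ?_⟩
    conv_lhs => rw [← hrank t ht, ← hPE]
    exact Matrix.rank_mul_le_left _ _

end RangeProjection

section Transport

variable {n : ℕ}

theorem exists_contDiffOn_transport {m : WithTop ℕ∞} {lo hi : ℝ} (hlohi : lo < hi)
    {P : ℝ → Matrix (Fin n) (Fin n) ℝ} (hP : ∀ i j, ContDiffOn ℝ m (fun t => P t i j) (Icc lo hi))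
    (hPP : ∀ t ∈ Icc lo hi, P t * P t = P t) :
    ∃ V : ℝ → Matrix (Fin n) (Fin n) ℝ,
      (∀ i j, ContDiffOn ℝ m (fun t => V t i j) (Icc lo hi)) ∧
      ∀ t ∈ Icc lo hi, IsUnit (V t) ∧ P t * V t = V t * P lo := by
  let U : ℝ × ℝ → Matrix (Fin n) (Fin n) ℝ := fun x => P x.1 * P x.2 + (1 - P x.1) * (1 - P x.2)
  have hU : ∀ {F : Type} [NormedAddCommGroup F] [NormedSpace ℝ F] {s : Set F} {f g : F → ℝ},
      ContDiff ℝ m f → ContDiff ℝ m g → MapsTo f s (Icc lo hi) → MapsTo g s (Icc lo hi) →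
      ∀ i j, ContDiffOn ℝ m (fun x => U (f x, g x) i j) s := by
    intro F _ _ s f g hf hg hfs hgs i j
    have hPf : ∀ i j, ContDiffOn ℝ m (fun x => P (f x) i j) s :=
      fun i j => (hP i j).comp hf.contDiffOn hfs
    have hPg : ∀ i j, ContDiffOn ℝ m (fun x => P (g x) i j) s :=
      fun i j => (hP i j).comp hg.contDiffOn hgs
    exact (contDiffOn_matrix_mul hPf hPg i j).add
      (contDiffOn_matrix_mul (fun i j => contDiffOn_const.sub (hPf i j))
        (fun i j => contDiffOn_const.sub (hPg i j)) i j)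
  have hdiag : ∀ t ∈ Icc lo hi, U (t, t) = 1 := by
    intro t ht
    simp only [U, Matrix.sub_mul, Matrix.mul_sub, Matrix.one_mul, Matrix.mul_one, hPP t ht]
    abel
  have hint : ∀ t ∈ Icc lo hi, ∀ u ∈ Icc lo hi, P t * U (t, u) = U (t, u) * P u := by
    intro t ht u hu
    simp only [U, Matrix.mul_add, Matrix.add_mul, Matrix.mul_assoc, Matrix.sub_mul,
      Matrix.one_mul, hPP u hu]
    simp only [Matrix.mul_sub, Matrix.mul_one, ← Matrix.mul_assoc, hPP t ht]
    abel
  have hcont : ContinuousOn (fun x => (U x).det) (Icc lo hi ×ˢ Icc lo hi) :=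
    (contDiffOn_matrix_det (hU (f := Prod.fst) (g := Prod.snd) contDiff_fst contDiff_snd
      (fun x hx => hx.1) fun x hx => hx.2)).continuousOn
  obtain ⟨δ, hδ, hclose⟩ := Metric.uniformContinuousOn_iff.1
    ((isCompact_Icc.prod isCompact_Icc).uniformContinuousOn_of_continuous hcont) 1 one_pos
  have hunit : ∀ t ∈ Icc lo hi, ∀ u ∈ Icc lo hi, |t - u| < δ → IsUnit (U (t, u)) := by
    intro t ht u hu htu
    have h := hclose (t, u) ⟨ht, hu⟩ (u, u) ⟨hu, hu⟩ (by simpa [Prod.dist_eq, Real.dist_eq, hδ])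
    rw [hdiag u hu, Matrix.det_one, Real.dist_eq] at h
    rw [Matrix.isUnit_iff_isUnit_det, isUnit_iff_ne_zero]
    intro h0
    simp [h0] at h
  obtain ⟨N, hN⟩ := exists_nat_gt ((hi - lo) / δ)
  have hN0 : (0 : ℝ) < N := (div_pos (sub_pos.2 hlohi) hδ).trans hN
  let σ : ℕ → ℝ → ℝ := fun i t => lo + i / N * (t - lo)
  have hσ : ∀ i, ContDiff ℝ m (σ i) := fun i =>
    contDiff_const.add (contDiff_const.mul (contDiff_id.sub contDiff_const))
  have hσmem : ∀ i ≤ N, MapsTo (σ i) (Icc lo hi) (Icc lo hi) := by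
    intro i hi' t ht
    have h1 : (i : ℝ) / N ≤ 1 := (div_le_one hN0).2 (by exact_mod_cast hi')
    have h0 : (0 : ℝ) ≤ i / N := by positivity
    constructor
    · nlinarith [ht.1, mul_nonneg h0 (sub_nonneg.2 ht.1)]
    · have := mul_le_mul_of_nonneg_right h1 (sub_nonneg.2 ht.1)
      simp only [σ]
      linarith [ht.2]
  have hstep : ∀ i, ∀ t ∈ Icc lo hi, |σ (i + 1) t - σ i t| < δ := by
    intro i t ht
    have h : σ (i + 1) t - σ i t = (t - lo) / N := by
      simp only [σ]
      push_cast
      field_simp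
      ring
    rw [h, abs_of_nonneg (div_nonneg (sub_nonneg.2 ht.1) hN0.le), div_lt_iff₀ hN0]
    rw [div_lt_iff₀ hδ] at hN
    linarith [ht.2]
  have main : ∀ i ≤ N, ∃ V : ℝ → Matrix (Fin n) (Fin n) ℝ,
      (∀ i j, ContDiffOn ℝ m (fun t => V t i j) (Icc lo hi)) ∧
      ∀ t ∈ Icc lo hi, IsUnit (V t) ∧ P (σ i t) * V t = V t * P lo := by
    intro i
    induction i with
    | zero =>
      intro _
      exact ⟨fun _ => 1, fun _ _ => contDiffOn_const, fun t _ => by simp [σ]⟩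
    | succ i ih =>
      intro hi'
      obtain ⟨V, hV, hV'⟩ := ih (by omega)
      have hm := hσmem (i + 1) hi'
      have hm' := hσmem i (by omega)
      refine ⟨fun t => U (σ (i + 1) t, σ i t) * V t,
        contDiffOn_matrix_mul (hU (hσ _) (hσ _) hm hm') hV, fun t ht => ⟨?_, ?_⟩⟩
      · exact (hunit _ (hm ht) _ (hm' ht) (hstep i t ht)).mul (hV' t ht).1
      · rw [← Matrix.mul_assoc, hint _ (hm ht) _ (hm' ht), Matrix.mul_assoc, (hV' t ht).2,
          Matrix.mul_assoc]
  obtain ⟨V, hV, hV'⟩ := main N le_rfl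
  refine ⟨V, hV, fun t ht => ?_⟩
  have : σ N t = t := by
    simp [σ, div_self hN0.ne']
  simpa [this] using hV' t ht

end Transport

section GramSchmidt

open InnerProductSpace

variable {G : Type*} [NormedAddCommGroup G] [InnerProductSpace ℝ G]
  {ι : Type*} [LinearOrder ι] [LocallyFiniteOrderBot ι] [WellFoundedLT ι]

theorem gramSchmidt_eq_sub_sum (f : ι → G) (i : ι) :
    gramSchmidt ℝ f i = f i - ∑ j ∈ Finset.Iio i,
      (inner ℝ (gramSchmidt ℝ f j) (f i) / ‖gramSchmidt ℝ f j‖ ^ 2) • gramSchmidt ℝ f j :=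
  eq_sub_of_add_eq (gramSchmidt_def'' ℝ f i).symm

theorem gramSchmidt_map_eq_smul {T : G →ₗ[ℝ] G} (hT : T.IsSymmetric) {f : ι → G} {c : ι → ℝ}
    (hf : ∀ i, T (f i) = c i • f i) (i : ι) :
    T (gramSchmidt ℝ f i) = c i • gramSchmidt ℝ f i := by
  induction i using WellFoundedLT.induction with
  | ind i ih =>
    rw [gramSchmidt_eq_sub_sum, map_sub, map_sum, smul_sub, Finset.smul_sum, hf]
    congr 1
    refine Finset.sum_congr rfl fun j hj => ?_
    have hj' := ih j (Finset.mem_Iio.1 hj)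
    have h := hT (gramSchmidt ℝ f j) (f i)
    rw [hj', hf, real_inner_smul_left, real_inner_smul_right] at h
    rw [map_smul, hj', smul_smul, smul_smul]
    congr 1
    linear_combination h / ‖gramSchmidt ℝ f j‖ ^ 2

theorem gramSchmidtNormed_map_eq_smul {T : G →ₗ[ℝ] G} (hT : T.IsSymmetric) {f : ι → G}
    {c : ι → ℝ} (hf : ∀ i, T (f i) = c i • f i) (i : ι) :
    T (gramSchmidtNormed ℝ f i) = c i • gramSchmidtNormed ℝ f i := by
  rw [gramSchmidtNormed, map_smul, gramSchmidt_map_eq_smul hT hf, smul_comm]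

variable {F : Type*} [NormedAddCommGroup F] [NormedSpace ℝ F] {m : WithTop ℕ∞} {s : Set F}

theorem contDiffOn_gramSchmidt {f : F → ι → G} (hf : ∀ i, ContDiffOn ℝ m (fun x => f x i) s)
    (hli : ∀ x ∈ s, LinearIndependent ℝ (f x)) (i : ι) :
    ContDiffOn ℝ m (fun x => gramSchmidt ℝ (f x) i) s := by
  induction i using WellFoundedLT.induction with
  | ind i ih =>
    simp only [gramSchmidt_eq_sub_sum _ i]
    refine (hf i).sub (ContDiffOn.sum fun j hj => ?_)
    have hj' := ih j (Finset.mem_Iio.1 hj)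
    refine ContDiffOn.smul (ContDiffOn.div (hj'.inner ℝ (hf i)) (hj'.norm_sq ℝ) ?_) hj'
    intro x hx
    exact pow_ne_zero 2 (norm_ne_zero_iff.2 (gramSchmidt_ne_zero j (hli x hx)))

theorem contDiffOn_gramSchmidtNormed {f : F → ι → G}
    (hf : ∀ i, ContDiffOn ℝ m (fun x => f x i) s)
    (hli : ∀ x ∈ s, LinearIndependent ℝ (f x)) (i : ι) :
    ContDiffOn ℝ m (fun x => gramSchmidtNormed ℝ (f x) i) s := by
  have h := contDiffOn_gramSchmidt hf hli i
  have hne : ∀ x ∈ s, gramSchmidt ℝ (f x) i ≠ 0 := fun x hx => gramSchmidt_ne_zero i (hli x hx)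
  exact ((h.norm ℝ hne).inv fun x hx => norm_ne_zero_iff.2 (hne x hx)).smul h

end GramSchmidt

section AdaptedFrame

variable {r n' : ℕ}

theorem exists_basis_of_isIdempotent {P : Matrix (Fin (r + n')) (Fin (r + n')) ℝ}
    (hP : P * P = P) (hr : P.rank = r) :
    ∃ b : Module.Basis (Fin (r + n')) ℝ (Fin (r + n') → ℝ),
      ∀ i, P *ᵥ b i = (Fin.append (fun _ : Fin r => (1 : ℝ)) (fun _ : Fin n' => 0) i) • b i := by
  have hidem : IsIdempotentElem P.mulVecLin := by
    change P.mulVecLin ∘ₗ P.mulVecLin = P.mulVecLin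
    rw [← Matrix.mulVecLin_mul, hP]
  have hker : Module.finrank ℝ (LinearMap.ker P.mulVecLin) = n' := by
    have h := P.mulVecLin.finrank_range_add_finrank_ker
    rw [Matrix.rank] at hr
    rw [hr, Module.finrank_fin_fun] at h
    omega
  let b₁ : Module.Basis (Fin r) ℝ (LinearMap.range P.mulVecLin) :=
    Module.finBasisOfFinrankEq ℝ _ hr
  let b₂ : Module.Basis (Fin n') ℝ (LinearMap.ker P.mulVecLin) :=
    Module.finBasisOfFinrankEq ℝ _ hker
  let b := ((b₁.prod b₂).map (Submodule.prodEquivOfIsCompl _ _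
    (LinearMap.IsIdempotentElem.isCompl hidem))).reindex finSumFinEquiv
  refine ⟨b, fun i => ?_⟩
  induction i using Fin.addCases with
  | left i =>
    have hb : b (Fin.castAdd n' i) = b₁ i := by simp [b]
    rw [hb, Fin.append_left, one_smul]
    exact (LinearMap.IsIdempotentElem.mem_range_iff hidem).1 (b₁ i).2
  | right i =>
    have hb : b (Fin.natAdd r i) = b₂ i := by simp [b]
    rw [hb, Fin.append_right, zero_smul]
    exact (b₂ i).2

/-- A smooth family of orthogonal projections of rank `r` on a compact interval admits a smooth
orthonormal frame adapted to it. -/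
theorem exists_contDiffOn_orthogonal_frame {m : WithTop ℕ∞} {lo hi : ℝ} (hlohi : lo < hi)
    {P : ℝ → Matrix (Fin (r + n')) (Fin (r + n')) ℝ}
    (hP : ∀ i j, ContDiffOn ℝ m (fun t => P t i j) (Icc lo hi))
    (hsymm : ∀ t ∈ Icc lo hi, (P t)ᵀ = P t) (hPP : ∀ t ∈ Icc lo hi, P t * P t = P t)
    (hr : (P lo).rank = r) :
    ∃ Q : ℝ → Matrix (Fin (r + n')) (Fin (r + n')) ℝ,
      (∀ i j, ContDiffOn ℝ m (fun t => Q t i j) (Icc lo hi)) ∧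
      ∀ t ∈ Icc lo hi, (Q t)ᵀ * Q t = 1 ∧ P t * Q t = Q t *
        Matrix.diagonal (Fin.append (fun _ : Fin r => (1 : ℝ)) (fun _ : Fin n' => 0)) := by
  obtain ⟨V, hV, hV'⟩ := exists_contDiffOn_transport hlohi hP hPP
  obtain ⟨b, hb⟩ := exists_basis_of_isIdempotent (hPP lo (left_mem_Icc.2 hlohi.le)) hr
  let f : ℝ → Fin (r + n') → EuclideanSpace ℝ (Fin (r + n')) :=
    fun t i => WithLp.toLp 2 (V t *ᵥ b i)
  have hf : ∀ i, ContDiffOn ℝ m (fun t => f t i) (Icc lo hi) := by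
    refine fun i => contDiffOn_euclidean.2 fun j => ?_
    simp only [f, Matrix.mulVec, dotProduct]
    exact ContDiffOn.sum fun l _ => (hV j l).mul contDiffOn_const
  have hli : ∀ t ∈ Icc lo hi, LinearIndependent ℝ (f t) := by
    intro t ht
    have h₁ : LinearIndependent ℝ fun i => (V t).mulVecLin (b i) :=
      b.linearIndependent.map' _
        (LinearMap.ker_eq_bot.2 (Matrix.mulVec_injective_iff_isUnit.2 (hV' t ht).1))
    exact h₁.map' (WithLp.linearEquiv 2 ℝ (Fin (r + n') → ℝ)).symm.toLinearMap
      (LinearEquiv.ker _)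
  refine ⟨fun t => Matrix.of fun i j => InnerProductSpace.gramSchmidtNormed ℝ (f t) j i,
    fun i j => contDiffOn_euclidean.1 (contDiffOn_gramSchmidtNormed hf hli j) i,
    fun t ht => ⟨?_, ?_⟩⟩
  · have ho := orthonormal_iff_ite.1 (InnerProductSpace.gramSchmidtNormed_orthonormal (hli t ht))
    ext i j
    rw [Matrix.one_apply, ← ho i j]
    simp [Matrix.mul_apply, PiLp.inner_apply, mul_comm]
  · have hT : (Matrix.toEuclideanLin (P t)).IsSymmetric :=
      Matrix.isSymmetric_toEuclideanLin_iff.2 (by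
        rw [Matrix.IsHermitian, Matrix.conjTranspose_eq_transpose_of_trivial, hsymm t ht])
    have hTf : ∀ i, Matrix.toEuclideanLin (P t) (f t i) =
        (Fin.append (fun _ : Fin r => (1 : ℝ)) (fun _ : Fin n' => 0) i) • f t i := by
      intro i
      rw [Matrix.toLpLin_toLp, Matrix.toLin'_apply, Matrix.mulVec_mulVec, (hV' t ht).2,
        ← Matrix.mulVec_mulVec, hb, Matrix.mulVec_smul, WithLp.toLp_smul]
    ext i j
    have h := congrArg (fun v : EuclideanSpace ℝ (Fin (r + n')) => v i) (gramSchmidtNormed_map_eq_smul hT hTf j)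
    rw [Matrix.mul_diagonal, Matrix.mul_apply]
    simpa [Matrix.mulVec, dotProduct, mul_comm] using h

end AdaptedFrame

/-- (Smooth rank decomposition under a symmetry of the kernel,
Theorem 2.7.)  Let `E : [lo, hi] → ℝ^{n×n}` be `k` times continuously differentiable with
`rank E(t) = r` and `ker E(t)ᵀ = ker E(t)` for all `t`.  Then there exists a `k` times
continuously differentiable, pointwise orthogonal matrix function `Q` such that
`Qᵀ E Q = [[Σ, 0], [0, 0]]` with `Σ : [lo, hi] → ℝ^{r×r}` `k` times continuously
differentiable and pointwise invertible. -/
theorem smooth_rank_decomposition_symm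
    (n r : ℕ) (lo hi : ℝ) (hlohi : lo < hi) (k : ℕ∞)
    (E : ℝ → Matrix (Fin n) (Fin n) ℝ)
    (hE : ∀ i j, ContDiffOn ℝ k (fun t => E t i j) (Set.Icc lo hi))
    (hrank : ∀ t ∈ Set.Icc lo hi, (E t).rank = r)
    (hker : ∀ t ∈ Set.Icc lo hi,
      LinearMap.ker (E t)ᵀ.mulVecLin = LinearMap.ker (E t).mulVecLin) :
    ∃ (n' : ℕ) (hn : r + n' = n)
      (Q : ℝ → Matrix (Fin n) (Fin n) ℝ)
      (Sig : ℝ → Matrix (Fin r) (Fin r) ℝ),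
      (∀ i j, ContDiffOn ℝ k (fun t => Q t i j) (Set.Icc lo hi)) ∧
      (∀ i j, ContDiffOn ℝ k (fun t => Sig t i j) (Set.Icc lo hi)) ∧
      (∀ t ∈ Set.Icc lo hi, (Q t)ᵀ * Q t = 1) ∧
      (∀ t ∈ Set.Icc lo hi, IsUnit (Sig t)) ∧
      (∀ t ∈ Set.Icc lo hi,
        (Q t)ᵀ * E t * Q t =
          Matrix.reindex (finSumFinEquiv.trans (finCongr hn))
            (finSumFinEquiv.trans (finCongr hn))
            (Matrix.fromBlocks (Sig t) 0 0 0)) := by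
  have hrn : r ≤ n := by
    rw [← hrank lo (left_mem_Icc.2 hlohi.le)]
    simpa using Matrix.rank_le_width (E lo)
  obtain ⟨n', rfl⟩ := Nat.exists_eq_add_of_le hrn
  obtain ⟨P, hP, hP'⟩ := exists_contDiffOn_range_projection hE hrank
  obtain ⟨Q, hQ, hQ'⟩ := exists_contDiffOn_orthogonal_frame hlohi hP (fun t ht => (hP' t ht).1)
    (fun t ht => (hP' t ht).2.1) (hP' lo (left_mem_Icc.2 hlohi.le)).2.2.2
  let D : Matrix (Fin (r + n')) (Fin (r + n')) ℝ :=
    Matrix.diagonal (Fin.append (fun _ : Fin r => (1 : ℝ)) (fun _ : Fin n' => 0))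
  have hQPt : ∀ t ∈ Icc lo hi, (Q t)ᵀ * P t = D * (Q t)ᵀ := by
    intro t ht
    have h := congrArg Matrix.transpose (hQ' t ht).2
    rwa [Matrix.transpose_mul, Matrix.transpose_mul, Matrix.diagonal_transpose,
      (hP' t ht).1] at h
  have hEP : ∀ t ∈ Icc lo hi, E t * P t = E t := by
    intro t ht
    obtain ⟨hs, hPP, hPE, -⟩ := hP' t ht
    have hEtP : (E t)ᵀ * (1 - P t) = 0 := by
      have h := congrArg Matrix.transpose hPE
      rw [Matrix.transpose_mul, hs] at h
      rw [Matrix.mul_sub, Matrix.mul_one, h, sub_self]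
    have h0 : E t * (1 - P t) = 0 := by
      apply Matrix.ext_of_mulVec_single
      intro j
      have hmem : (1 - P t) *ᵥ Pi.single j 1 ∈ LinearMap.ker (E t)ᵀ.mulVecLin := by
        rw [LinearMap.mem_ker, Matrix.mulVecLin_apply, Matrix.mulVec_mulVec, hEtP,
          Matrix.zero_mulVec]
      rw [hker t ht, LinearMap.mem_ker, Matrix.mulVecLin_apply, Matrix.mulVec_mulVec] at hmem
      rw [hmem, Matrix.zero_mulVec]
    rw [Matrix.mul_sub, Matrix.mul_one] at h0
    exact (sub_eq_zero.1 h0).symm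
  let M : ℝ → Matrix (Fin (r + n')) (Fin (r + n')) ℝ := fun t => (Q t)ᵀ * E t * Q t
  have hM : ∀ i j, ContDiffOn ℝ k (fun t => M t i j) (Icc lo hi) :=
    contDiffOn_matrix_mul (contDiffOn_matrix_mul (fun i j => hQ j i) hE) hQ
  have hDM : ∀ t ∈ Icc lo hi, D * M t = M t := by
    intro t ht
    simp only [M]
    rw [← Matrix.mul_assoc, ← Matrix.mul_assoc, ← hQPt t ht, Matrix.mul_assoc (Q t)ᵀ,
      (hP' t ht).2.2.1]
  have hMD : ∀ t ∈ Icc lo hi, M t * D = M t := by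
    intro t ht
    simp only [M]
    rw [Matrix.mul_assoc, ← (hQ' t ht).2, ← Matrix.mul_assoc, Matrix.mul_assoc (Q t)ᵀ,
      hEP t ht]
  let Sig : ℝ → Matrix (Fin r) (Fin r) ℝ :=
    fun t => (M t).submatrix (Fin.castAdd n') (Fin.castAdd n')
  have hblock : ∀ t ∈ Icc lo hi, M t = Matrix.reindex finSumFinEquiv finSumFinEquiv
      (Matrix.fromBlocks (Sig t) 0 0 (0 : Matrix (Fin n') (Fin n') ℝ)) := by
    intro t ht
    ext i j
    induction j using Fin.addCases with
    | left j =>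
      induction i using Fin.addCases with
      | left i => simp [Sig]
      | right i =>
        rw [← hDM t ht, Matrix.diagonal_mul]
        simp
    | right j =>
      rw [← hMD t ht, Matrix.mul_diagonal]
      induction i using Fin.addCases <;> simp
  refine ⟨n', rfl, Q, Sig, hQ, fun i j => hM _ _, fun t ht => (hQ' t ht).1, fun t ht => ?_,
    fun t ht => by simpa using hblock t ht⟩
  have hQu : IsUnit (Q t).det :=
    (Matrix.isUnit_iff_isUnit_det _).1 (IsUnit.of_mul_eq_one_right _ (hQ' t ht).1)
  have hrM : (M t).rank = r := by
    simp only [M]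
    rw [Matrix.rank_mul_eq_left_of_isUnit_det _ _ hQu, Matrix.rank_mul_eq_right_of_isUnit_det _ _
      (by rwa [Matrix.det_transpose]), hrank t ht]
  have hfac : Matrix.fromBlocks (Sig t) 0 0 (0 : Matrix (Fin n') (Fin n') ℝ) =
      Matrix.fromRows (1 : Matrix (Fin r) (Fin r) ℝ) (0 : Matrix (Fin n') (Fin r) ℝ) *
        (Sig t * Matrix.fromCols (1 : Matrix (Fin r) (Fin r) ℝ) (0 : Matrix (Fin r) (Fin n') ℝ)) := by
    ext (i | i) (j | j) <;> simp [Matrix.mul_fromCols, Matrix.fromRows_mul]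
  refine isUnit_of_rank_eq (le_antisymm (by simpa using Matrix.rank_le_width (Sig t)) ?_)
  rw [hblock t ht, Matrix.rank_reindex, hfac] at hrM
  calc r = _ := hrM.symm
    _ ≤ _ := (Matrix.rank_mul_le_right _ _).trans (Matrix.rank_mul_le_left _ _)
end

section
/- Let I ⊆ ℝ be an interval, t₀ ∈ I, p ∈ ℕ, J = [[0, I_p],[−I_p, 0]] ∈ ℝ^{2p×2p}, and let C : I → ℝ^{2p×2p} be continuous with C(t)ᵀ = C(t) for all t ∈ I. If Φ : I → ℝ^{2p×2p} is differentiable with Φ̇(t) = J⁻¹C(t)Φ(t) for all t ∈ I and Φ(t₀) = I_{2p}, then Φ(t)ᵀJΦ(t) = J for all t ∈ I; that is, the flow is symplectic. -/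
open Matrix

/-- The canonical skew-symmetric matrix `J = [[0, I_p], [-I_p, 0]]` of size `2p × 2p`. -/
noncomputable def Jmat (p : ℕ) : Matrix (Fin p ⊕ Fin p) (Fin p ⊕ Fin p) ℝ :=
  Matrix.fromBlocks 0 1 (-1) 0

/-- Entrywise product rule for matrix-valued functions of a real variable. -/
theorem hasDerivWithinAt_matrix_mul_apply {l m n : Type*} [Fintype m]
    {A : ℝ → Matrix l m ℝ} {B : ℝ → Matrix m n ℝ} {A' : Matrix l m ℝ} {B' : Matrix m n ℝ}
    {s : Set ℝ} {t : ℝ}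
    (hA : ∀ i j, HasDerivWithinAt (fun u => A u i j) (A' i j) s t)
    (hB : ∀ i j, HasDerivWithinAt (fun u => B u i j) (B' i j) s t) (i : l) (j : n) :
    HasDerivWithinAt (fun u => (A u * B u) i j) ((A' * B t + A t * B') i j) s t := by
  simp only [Matrix.add_apply, Matrix.mul_apply, ← Finset.sum_add_distrib]
  exact HasDerivWithinAt.fun_sum fun k _ => (hA i k).fun_mul (hB k j)

theorem Jmat_mul_self (p : ℕ) : Jmat p * Jmat p = -1 := by
  simp [Jmat, Matrix.fromBlocks_multiply, ← Matrix.fromBlocks_one, Matrix.fromBlocks_neg]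

theorem Jmat_transpose (p : ℕ) : (Jmat p)ᵀ = -Jmat p := by
  simp [Jmat, Matrix.fromBlocks_transpose, Matrix.fromBlocks_neg]

theorem Jmat_inv (p : ℕ) : (Jmat p)⁻¹ = -Jmat p :=
  Matrix.inv_eq_right_inv (by rw [mul_neg, Jmat_mul_self, neg_neg])

/-- The derivative of `ΦᵀJΦ` along a linear Hamiltonian flow vanishes. -/
theorem hamiltonian_transpose_mul_Jmat_add {p : ℕ}
    {C : Matrix (Fin p ⊕ Fin p) (Fin p ⊕ Fin p) ℝ} (hC : Cᵀ = C)
    (X : Matrix (Fin p ⊕ Fin p) (Fin p ⊕ Fin p) ℝ) :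
    ((Jmat p)⁻¹ * C * X)ᵀ * Jmat p * X + Xᵀ * Jmat p * ((Jmat p)⁻¹ * C * X) = 0 := by
  have h₁ : ((Jmat p)⁻¹ * C * X)ᵀ * Jmat p * X = Xᵀ * C * (Jmat p * Jmat p) * X := by
    simp [Jmat_inv, Jmat_transpose, Matrix.transpose_mul, hC, Matrix.mul_assoc]
  have h₂ : Xᵀ * Jmat p * ((Jmat p)⁻¹ * C * X) = -(Xᵀ * (Jmat p * Jmat p) * C * X) := by
    simp [Jmat_inv, Matrix.mul_assoc]
  rw [h₁, h₂, Jmat_mul_self]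
  simp

/-- (Symplectic flow.)  Let `I` be an interval, `t₀ ∈ I`, and let
`C : I → ℝ^{2p×2p}` be continuous with `C(t)ᵀ = C(t)`.  If `Φ` is differentiable with
`Φ̇(t) = J⁻¹ C(t) Φ(t)` on `I` and `Φ(t₀) = I`, then `Φ(t)ᵀ J Φ(t) = J` for all `t ∈ I`,
i.e. the flow is symplectic. -/
theorem flow_symplectic (p : ℕ) (I : Set ℝ) (hI : I.OrdConnected) (t₀ : ℝ) (ht₀ : t₀ ∈ I)
    (C : ℝ → Matrix (Fin p ⊕ Fin p) (Fin p ⊕ Fin p) ℝ)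
    (hC : ∀ i j, ContinuousOn (fun t => C t i j) I)
    (hCsymm : ∀ t ∈ I, (C t)ᵀ = C t)
    (Φ : ℝ → Matrix (Fin p ⊕ Fin p) (Fin p ⊕ Fin p) ℝ)
    (hΦ : ∀ t ∈ I, ∀ i j,
      HasDerivWithinAt (fun s => Φ s i j) (((Jmat p)⁻¹ * C t * Φ t) i j) I t)
    (hΦ0 : Φ t₀ = 1) :
    ∀ t ∈ I, (Φ t)ᵀ * Jmat p * Φ t = Jmat p := by
  intro t ht
  ext i j
  have hderiv : ∀ u ∈ I, HasDerivWithinAt (fun s => ((Φ s)ᵀ * Jmat p * Φ s) i j) 0 I u := by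
    intro u hu
    have hΦJ := hasDerivWithinAt_matrix_mul_apply (A := fun s => (Φ s)ᵀ)
      (A' := ((Jmat p)⁻¹ * C u * Φ u)ᵀ) (B := fun _ => Jmat p) (B' := 0)
      (fun a b => hΦ u hu b a) (fun a b => hasDerivWithinAt_const u I (Jmat p a b))
    have h := hasDerivWithinAt_matrix_mul_apply hΦJ (hΦ u hu) i j
    rwa [Matrix.mul_zero, add_zero, hamiltonian_transpose_mul_Jmat_add (hCsymm u hu),
      Matrix.zero_apply] at h
  have h := hI.convex.norm_image_sub_le_of_norm_hasDerivWithin_le (C := 0) hderiv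
    (fun u _ => norm_zero.le) ht₀ ht
  rw [zero_mul, norm_le_zero_iff, sub_eq_zero] at h
  simpa [hΦ0] using h
end

section
/- Smooth Sylvester law of inertia: Let I ⊆ ℝ be a compact nontrivial interval, k ∈ ℕ ∪ {∞}, and let Δ : I → ℝ^{n×n} be k times continuously differentiable with Δ(t)ᵀ = Δ(t) and Δ(t) invertible for every t ∈ I. Then there exist p, q ∈ ℕ with p + q = n and a k times continuously differentiable matrix function W : I → ℝ^{n×n} with W(t) invertible for every t ∈ I such that W(t)ᵀΔ(t)W(t) = diag(I_p, −I_q) for all t ∈ I. -/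
open Matrix

section SqrtOneAdd

variable {A : Type*} [NormedRing A] [NormedAlgebra ℝ A]

/-- In any real normed algebra, the binomial series converges on the unit ball. -/
theorem one_le_radius_binomialSeries (A : Type*) [NormedRing A] [NormedAlgebra ℝ A] (a : ℝ) :
    1 ≤ (binomialSeries A a).radius := by
  refine (binomialSeries_radius_ge_one (𝕂 := ℝ) (𝔸 := ℝ) (a := a)).trans ?_
  refine ENNReal.le_of_forall_nnreal_lt fun r hr => ?_
  refine FormalMultilinearSeries.le_radius_of_summable_norm _ ?_
  refine Summable.of_norm_bounded_eventually_nat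
    ((binomialSeries ℝ a).summable_norm_mul_pow hr) ?_
  filter_upwards [Filter.eventually_gt_atTop 0] with n hn
  rw [norm_mul, norm_norm, norm_pow, NNReal.norm_eq]
  gcongr
  refine (FormalMultilinearSeries.ofScalars_norm_le A (Ring.choose a ·) n hn).trans_eq ?_
  exact (FormalMultilinearSeries.ofScalars_norm ℝ (Ring.choose a ·) n).symm

/-- The square root of `1 + y`, given by its binomial series. -/
noncomputable def sqrtOneAdd (y : A) : A := (binomialSeries A (1 / 2 : ℝ)).sum y

theorem mem_eball_radius_binomialSeries {y : A} (hy : ‖y‖ < 1) (a : ℝ) :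
    y ∈ Metric.eball (0 : A) (binomialSeries A a).radius := by
  refine Metric.eball_subset_eball (one_le_radius_binomialSeries A a) ?_
  rw [mem_eball_zero_iff, ← ofReal_norm]
  exact ENNReal.ofReal_lt_one.2 hy

variable [CompleteSpace A]

theorem hasSum_sqrtOneAdd {y : A} (hy : ‖y‖ < 1) :
    HasSum (fun n => Ring.choose (1 / 2 : ℝ) n • y ^ n) (sqrtOneAdd y) := by
  simpa [sqrtOneAdd] using
    (binomialSeries A (1 / 2 : ℝ)).hasSum (mem_eball_radius_binomialSeries hy _)

theorem sqrtOneAdd_mul_self {y : A} (hy : ‖y‖ < 1) :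
    sqrtOneAdd y * sqrtOneAdd y = 1 + y := by
  have hs : Summable fun n => ‖Ring.choose (1 / 2 : ℝ) n • y ^ n‖ := by
    simpa using (binomialSeries A (1 / 2 : ℝ)).summable_norm_apply
      (mem_eball_radius_binomialSeries hy _)
  rw [← (hasSum_sqrtOneAdd hy).tsum_eq,
    tsum_mul_tsum_eq_tsum_sum_antidiagonal_of_summable_norm hs hs]
  have hc : ∀ n, ∑ kl ∈ Finset.HasAntidiagonal.antidiagonal n,
      Ring.choose (1 / 2 : ℝ) kl.1 • y ^ kl.1 * Ring.choose (1 / 2 : ℝ) kl.2 • y ^ kl.2 =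
      (Nat.choose 1 n : ℝ) • y ^ n := by
    intro n
    have h1 : ((1 : ℕ) : ℝ) = 1 / 2 + 1 / 2 := by norm_num
    rw [← Ring.choose_natCast, h1, Ring.add_choose_eq n (Commute.all _ _), Finset.sum_smul]
    refine Finset.sum_congr rfl fun kl hkl => ?_
    rw [smul_mul_smul_comm, ← pow_add, Finset.HasAntidiagonal.mem_antidiagonal.1 hkl]
  simp_rw [hc]
  rw [tsum_eq_sum (s := Finset.range 2)]
  · simp [Finset.sum_range_succ]
  · intro n hn
    rw [Nat.choose_eq_zero_of_lt (by simpa using hn)]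
    simp

theorem contDiffAt_sqrtOneAdd {y : A} (hy : ‖y‖ < 1) {m : WithTop ℕ∞} :
    ContDiffAt ℝ m sqrtOneAdd y :=
  (((binomialSeries A (1 / 2 : ℝ)).hasFPowerSeriesOnBall
    (zero_lt_one.trans_le (one_le_radius_binomialSeries A _))).analyticAt_of_mem
      (mem_eball_radius_binomialSeries hy _)).contDiffAt

end SqrtOneAdd

section MatrixFunctions

open scoped Matrix.Norms.Operator

variable {ι : Type*} [Fintype ι] [DecidableEq ι]

theorem transpose_sqrtOneAdd_mul {S Y : Matrix ι ι ℝ} (hY : ‖Y‖ < 1) (hS : Yᵀ * S = S * Y) :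
    (sqrtOneAdd Y)ᵀ * S = S * sqrtOneAdd Y := by
  have hpow : ∀ n : ℕ, (Y ^ n)ᵀ * S = S * Y ^ n := fun n => by
    rw [transpose_pow]
    exact (SemiconjBy.pow_right (show SemiconjBy S Y Yᵀ from hS.symm) n).eq.symm
  have h := hasSum_sqrtOneAdd hY
  refine (h.matrix_transpose.mul_right S).unique ?_
  simpa only [transpose_smul, smul_mul, Matrix.mul_smul, hpow] using! h.mul_left S

/-- If `S` and `T` are symmetric and `S` is invertible, then `S` is carried to `T` by the
congruence with the square root of `S⁻¹ * T`, provided the latter is close to `1`. -/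
theorem transpose_sqrtOneAdd_mul_mul {S T : Matrix ι ι ℝ} (hS : Sᵀ = S) (hT : Tᵀ = T)
    (hSu : IsUnit S) (hST : ‖S⁻¹ * T - 1‖ < 1) :
    (sqrtOneAdd (S⁻¹ * T - 1))ᵀ * S * sqrtOneAdd (S⁻¹ * T - 1) = T := by
  have hd : IsUnit S.det := (isUnit_iff_isUnit_det S).1 hSu
  rw [transpose_sqrtOneAdd_mul hST, mul_assoc, sqrtOneAdd_mul_self hST, add_sub_cancel,
    mul_nonsing_inv_cancel_left _ _ hd]
  rw [transpose_sub, transpose_mul, transpose_nonsing_inv, hS, hT, transpose_one, sub_mul,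
    mul_sub, nonsing_inv_mul_cancel_right _ _ hd, mul_nonsing_inv_cancel_left _ _ hd,
    one_mul, mul_one]

theorem contDiffOn_matrix_iff {s : Set ℝ} {m : WithTop ℕ∞} {M : ℝ → Matrix ι ι ℝ} :
    ContDiffOn ℝ m M s ↔ ∀ i j, ContDiffOn ℝ m (fun t => M t i j) s := by
  refine ⟨fun h i j => ?_, fun h => ?_⟩
  · exact (LinearMap.toContinuousLinearMap (entryLinearMap ℝ ℝ i j)).contDiff.comp_contDiffOn h
  · have hM : M = fun t => ∑ i, ∑ j, M t i j • Matrix.single i j (1 : ℝ) := by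
      funext t
      simpa [smul_single] using matrix_eq_sum_single (M t)
    rw [hM]
    exact ContDiffOn.sum fun i _ => ContDiffOn.sum fun j _ => (h i j).smul contDiffOn_const

theorem ContDiffOn.matrix_inv {s : Set ℝ} {m : WithTop ℕ∞} {M : ℝ → Matrix ι ι ℝ}
    (hM : ContDiffOn ℝ m M s) (hu : ∀ t ∈ s, IsUnit (M t)) :
    ContDiffOn ℝ m (fun t => (M t)⁻¹) s := by
  intro t ht
  obtain ⟨u, hu'⟩ := hu t ht
  have h := contDiffAt_ringInverse ℝ (n := m) u
  rw [hu'] at h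
  simpa [Function.comp_def, nonsing_inv_eq_ringInverse] using
    h.comp_contDiffWithinAt t (hM t ht)

theorem exists_forall_norm_inv_mul_sub_one_lt {s : Set ℝ} (hs : IsCompact s)
    {M : ℝ → Matrix ι ι ℝ} (hM : ContinuousOn M s) (hu : ∀ t ∈ s, IsUnit (M t)) :
    ∃ δ > 0, ∀ a ∈ s, ∀ b ∈ s, |b - a| < δ → ‖(M a)⁻¹ * M b - 1‖ < 1 := by
  have hinv : ContinuousOn (fun t => (M t)⁻¹) s :=
    (ContDiffOn.matrix_inv (contDiffOn_zero.2 hM) hu).continuousOn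
  have hc : ContinuousOn (fun x : ℝ × ℝ => (M x.1)⁻¹ * M x.2) (s ×ˢ s) :=
    (hinv.comp continuousOn_fst fun x hx => hx.1).mul
      (hM.comp continuousOn_snd fun x hx => hx.2)
  obtain ⟨δ, hδ, h⟩ := Metric.uniformContinuousOn_iff.1
    ((hs.prod hs).uniformContinuousOn_of_continuous hc) 1 one_pos
  refine ⟨δ, hδ, fun a ha b hb hab => ?_⟩
  have h' := h (a, b) ⟨ha, hb⟩ (a, a) ⟨ha, ha⟩ (by
    rwa [dist_prod_same_left, Real.dist_eq])
  simpa [dist_eq_norm, nonsing_inv_mul _ ((isUnit_iff_isUnit_det _).1 (hu a ha))] using h'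

/-- A smooth curve of symmetric invertible matrices on a compact interval is smoothly congruent
to its constant initial value. -/
theorem exists_contDiffOn_congruence_left {lo hi : ℝ} (hlohi : lo < hi) {m : WithTop ℕ∞}
    {M : ℝ → Matrix ι ι ℝ} (hM : ContDiffOn ℝ m M (Set.Icc lo hi))
    (hsymm : ∀ t ∈ Set.Icc lo hi, (M t)ᵀ = M t) (hu : ∀ t ∈ Set.Icc lo hi, IsUnit (M t)) :
    ∃ W : ℝ → Matrix ι ι ℝ, ContDiffOn ℝ m W (Set.Icc lo hi) ∧
      ∀ t ∈ Set.Icc lo hi, (W t)ᵀ * M t * W t = M lo := by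
  obtain ⟨δ, hδ, hclose⟩ := exists_forall_norm_inv_mul_sub_one_lt isCompact_Icc hM.continuousOn hu
  obtain ⟨N, hN⟩ := exists_nat_gt ((hi - lo) / δ)
  have hN0 : (0 : ℝ) < N := (div_pos (sub_pos.2 hlohi) hδ).trans hN
  let τ : ℕ → ℝ → ℝ := fun i t => lo + i / N * (t - lo)
  have hτmem : ∀ i ≤ N, ∀ t ∈ Set.Icc lo hi, τ i t ∈ Set.Icc lo hi := by
    intro i hi' t ht
    have h0 : (0 : ℝ) ≤ i / N := by positivity
    have h1 : (i : ℝ) / N ≤ 1 := (div_le_one hN0).2 (by exact_mod_cast hi')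
    have h2 := sub_nonneg.2 ht.1
    have h3 := mul_nonneg h0 h2
    have h4 := mul_le_of_le_one_left h2 h1
    exact ⟨by simp only [τ]; linarith, by simp only [τ]; linarith [ht.2]⟩
  have hMτ : ∀ i ≤ N, ContDiffOn ℝ m (fun t => M (τ i t)) (Set.Icc lo hi) := fun i hi' =>
    hM.comp (by fun_prop) (hτmem i hi')
  have key : ∀ i ≤ N, ∃ W : ℝ → Matrix ι ι ℝ, ContDiffOn ℝ m W (Set.Icc lo hi) ∧
      ∀ t ∈ Set.Icc lo hi, (W t)ᵀ * M (τ i t) * W t = M lo := by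
    intro i
    induction i with
    | zero => exact fun _ => ⟨fun _ => 1, contDiffOn_const, fun t _ => by simp [τ]⟩
    | succ i ih =>
      intro hi'
      obtain ⟨W, hW, hWM⟩ := ih (by omega)
      have hnorm : ∀ t ∈ Set.Icc lo hi, ‖(M (τ (i + 1) t))⁻¹ * M (τ i t) - 1‖ < 1 := by
        intro t ht
        refine hclose _ (hτmem _ hi' t ht) _ (hτmem _ (by omega) t ht) ?_
        have : τ i t - τ (i + 1) t = -((t - lo) / N) := by
          simp only [τ]; push_cast; ring
        rw [this, abs_neg, abs_of_nonneg (div_nonneg (sub_nonneg.2 ht.1) hN0.le), div_lt_iff₀ hN0]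
        rw [div_lt_iff₀ hδ] at hN
        linarith [ht.2]
      refine ⟨fun t => sqrtOneAdd ((M (τ (i + 1) t))⁻¹ * M (τ i t) - 1) * W t, ?_, ?_⟩
      · have hX : ContDiffOn ℝ m (fun t => (M (τ (i + 1) t))⁻¹ * M (τ i t) - 1)
            (Set.Icc lo hi) :=
          (((hMτ _ hi').matrix_inv fun t ht => hu _ (hτmem _ hi' t ht)).mul
            (hMτ i (by omega))).sub contDiffOn_const
        exact ContDiffOn.mul (fun t ht =>
          (contDiffAt_sqrtOneAdd (hnorm t ht)).comp_contDiffWithinAt t (hX t ht)) hW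
      · intro t ht
        have h := transpose_sqrtOneAdd_mul_mul (hsymm _ (hτmem _ hi' t ht))
          (hsymm _ (hτmem i (by omega) t ht)) (hu _ (hτmem _ hi' t ht)) (hnorm t ht)
        rw [← hWM t ht]
        refine Eq.trans ?_ (congrArg (fun X => (W t)ᵀ * X * W t) h)
        simp only [transpose_mul, mul_assoc]
  obtain ⟨W, hW, hWM⟩ := key N le_rfl
  refine ⟨W, hW, fun t ht => ?_⟩
  simpa [τ, div_self hN0.ne'] using hWM t ht

end MatrixFunctions

theorem exists_forall_iff_val_lt_of_antitone {n : ℕ} {P : Fin n → Prop}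
    (hP : ∀ i j, i ≤ j → P j → P i) : ∃ p ≤ n, ∀ i : Fin n, P i ↔ (i : ℕ) < p := by
  classical
  by_cases h : ∃ m, ∃ hm : m < n, ¬ P ⟨m, hm⟩
  · obtain ⟨hlt, hnot⟩ := Nat.find_spec h
    refine ⟨Nat.find h, hlt.le, fun i => ⟨fun hi => ?_, fun hi => ?_⟩⟩
    · by_contra hle
      exact hnot (hP ⟨_, hlt⟩ i (not_lt.1 hle) hi)
    · by_contra hi'
      exact Nat.find_min h hi ⟨i.2, hi'⟩
  · push Not at h
    exact ⟨n, le_rfl, fun i => ⟨fun _ => i.2, fun _ => h i i.2⟩⟩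

/-- **Sylvester's law of inertia** for a symmetric invertible real matrix. -/
theorem exists_transpose_mul_mul_eq_diagonal_one_neg_one {n : ℕ} {S : Matrix (Fin n) (Fin n) ℝ}
    (hS : Sᵀ = S) (hu : IsUnit S) :
    ∃ p ≤ n, ∃ V : Matrix (Fin n) (Fin n) ℝ,
      Vᵀ * S * V = diagonal (fun i : Fin n => if (i : ℕ) < p then (1 : ℝ) else -1) := by
  have hH : S.IsHermitian := by rwa [IsHermitian, conjTranspose_eq_transpose_of_trivial]
  let U : Matrix (Fin n) (Fin n) ℝ := hH.eigenvectorUnitary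
  have hUS : Uᵀ * S * U = diagonal hH.eigenvalues := by
    have h := hH.conjStarAlgAut_star_eigenvectorUnitary
    rw [Unitary.conjStarAlgAut_star_apply] at h
    simpa [U, star_eq_conjTranspose, conjTranspose_eq_transpose_of_trivial, Function.comp_def]
      using h
  have hne : ∀ i, hH.eigenvalues i ≠ 0 := by
    have hdet := ((isUnit_iff_isUnit_det S).1 hu).ne_zero
    rw [hH.det_eq_prod_eigenvalues] at hdet
    intro i hi
    exact hdet (Finset.prod_eq_zero (Finset.mem_univ i) (by simp [hi]))
  let σ := Tuple.sort fun i => -hH.eigenvalues i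
  let μ : Fin n → ℝ := fun i => hH.eigenvalues (σ i)
  have hμ : Antitone μ := fun i j hij =>
    neg_le_neg_iff.1 (Tuple.monotone_sort (fun i => -hH.eigenvalues i) hij)
  obtain ⟨p, hpn, hp⟩ := exists_forall_iff_val_lt_of_antitone (P := fun i => 0 < μ i)
    fun i j hij hj => hj.trans_le (hμ hij)
  refine ⟨p, hpn, U.submatrix id σ * diagonal fun i => (√|μ i|)⁻¹, ?_⟩
  have hperm : (U.submatrix id σ)ᵀ * S * U.submatrix id σ = diagonal μ := by
    have h : (U.submatrix id σ)ᵀ * S * U.submatrix id σ = (Uᵀ * S * U).submatrix σ σ := rfl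
    rw [h, hUS, submatrix_diagonal_equiv]
    rfl
  rw [transpose_mul, diagonal_transpose]
  calc _ = diagonal (fun i => (√|μ i|)⁻¹) * ((U.submatrix id σ)ᵀ * S * U.submatrix id σ) *
        diagonal (fun i => (√|μ i|)⁻¹) := by simp only [mul_assoc]
    _ = _ := by
      rw [hperm, diagonal_mul_diagonal, diagonal_mul_diagonal]
      congr 1
      funext i
      have hi : μ i ≠ 0 := hne _
      have hsq : (√|μ i|)⁻¹ * μ i * (√|μ i|)⁻¹ = μ i / |μ i| := by
        rw [mul_right_comm, ← mul_inv, Real.mul_self_sqrt (abs_nonneg _), inv_mul_eq_div]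
      rw [hsq]
      by_cases h : 0 < μ i
      · rw [if_pos ((hp i).1 h), abs_of_pos h, div_self hi]
      · rw [if_neg (mt (hp i).2 h), abs_of_neg (lt_of_le_of_ne (not_lt.1 h) hi), div_neg,
          div_self hi]

/-- (Smooth Sylvester law of inertia.)  Let `Δ : [lo, hi] → ℝ^{n×n}` be
`k` times continuously differentiable, pointwise symmetric and pointwise invertible.
Then there exist `p, q` with `p + q = n` and a `k` times continuously differentiable,
pointwise invertible matrix function `W` such that
`W(t)ᵀ Δ(t) W(t) = diag(I_p, -I_q)` for all `t ∈ [lo, hi]`. -/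
theorem smooth_sylvester_inertia
    (n : ℕ) (lo hi : ℝ) (hlohi : lo < hi) (k : ℕ∞)
    (Δ : ℝ → Matrix (Fin n) (Fin n) ℝ)
    (hΔ : ∀ i j, ContDiffOn ℝ k (fun t => Δ t i j) (Set.Icc lo hi))
    (hsymm : ∀ t ∈ Set.Icc lo hi, (Δ t)ᵀ = Δ t)
    (hinv : ∀ t ∈ Set.Icc lo hi, IsUnit (Δ t)) :
    ∃ (p q : ℕ), p + q = n ∧
      ∃ W : ℝ → Matrix (Fin n) (Fin n) ℝ,
        (∀ i j, ContDiffOn ℝ k (fun t => W t i j) (Set.Icc lo hi)) ∧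
        (∀ t ∈ Set.Icc lo hi, IsUnit (W t)) ∧
        (∀ t ∈ Set.Icc lo hi,
          (W t)ᵀ * Δ t * W t =
            Matrix.diagonal (fun i : Fin n => if (i : ℕ) < p then (1 : ℝ) else -1)) := by
  obtain ⟨W, hW, hWΔ⟩ := exists_contDiffOn_congruence_left hlohi
    (contDiffOn_matrix_iff.2 hΔ) hsymm hinv
  obtain ⟨p, hpn, V, hV⟩ := exists_transpose_mul_mul_eq_diagonal_one_neg_one
    (hsymm lo (Set.left_mem_Icc.2 hlohi.le)) (hinv lo (Set.left_mem_Icc.2 hlohi.le))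
  have hmain : ∀ t ∈ Set.Icc lo hi, (W t * V)ᵀ * Δ t * (W t * V) =
      diagonal (fun i : Fin n => if (i : ℕ) < p then (1 : ℝ) else -1) := by
    intro t ht
    rw [← hV, ← hWΔ t ht, transpose_mul]
    simp only [mul_assoc]
  refine ⟨p, n - p, Nat.add_sub_cancel' hpn, fun t => W t * V, ?_, fun t ht => ?_, hmain⟩
  · intro i j
    simp only [mul_apply]
    exact ContDiffOn.sum fun l _ => (contDiffOn_matrix_iff.1 hW i l).mul contDiffOn_const
  · rw [isUnit_iff_isUnit_det]
    refine isUnit_of_mul_isUnit_right (x := ((W t * V)ᵀ * Δ t).det) ?_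
    rw [← det_mul, hmain t ht, det_diagonal, isUnit_iff_ne_zero, Finset.prod_ne_zero_iff]
    intro i _
    split_ifs <;> norm_num
end
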